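/- arXiv:1801.05799 — 3 statements merged into one kernel-verified Lean document; each statement's English description precedes it below -/
import Mathlib

section
/- Let 1 < q < p < ∞ and let a, b ∈ ℝ satisfy −1/p < a < 1−1/p, −1/q < b < 1−1/q and (b−a)·pq/(p−q) > −1. Define s by 1/s = 1/q − 1/p. Then M(Λ_{p,t^{ap}}, Λ_{q,t^{bq}}) = Λ_{s,t^{(b−a)s}}: a measurable x on (0,∞) satisfies x·y ∈ Λ_{q,t^{bq}} for every y ∈ Λ_{p,t^{ap}} if and only if ∫_0^∞ x*(t)^s t^{(b−a)s} dt < ∞. -/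
open MeasureTheory Set
open scoped ENNReal

/-- The decreasing rearrangement of `x` on the interval `I ⊆ (0,∞)`:
`x*(t) = inf {λ > 0 : m({s ∈ I : |x(s)| > λ}) ≤ t}` (with `inf ∅ = ∞`). -/
noncomputable def rearr (I : Set ℝ) (x : ℝ → ℝ) (t : ℝ) : ℝ≥0∞ :=
  sInf (ENNReal.ofReal ''
    {a : ℝ | 0 < a ∧ volume {s : ℝ | s ∈ I ∧ a < |x s|} ≤ ENNReal.ofReal t})

/-- Membership in the Lorentz class `Λ_{p,w}`: `∫_0^∞ x*(t)^p w(t) dt < ∞`. -/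
def lambdaMem (p : ℝ) (w : ℝ → ℝ) (x : ℝ → ℝ) : Prop :=
  (∫⁻ t in Ioi (0:ℝ), rearr (Ioi 0) x t ^ p * ENNReal.ofReal (w t)) < ⊤

theorem rearr_le_of_volume_le {I : Set ℝ} {x : ℝ → ℝ} {t : ℝ} {l : ℝ≥0∞}
    (h : volume {s : ℝ | s ∈ I ∧ l < ENNReal.ofReal |x s|} ≤ ENNReal.ofReal t) :
    rearr I x t ≤ l := by
  refine le_of_forall_gt fun m hm => ?_
  obtain ⟨c, -, hlc, hcm⟩ := ENNReal.lt_iff_exists_real_btwn.1 hm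
  have hc : 0 < c := by
    by_contra hc
    simp [ENNReal.ofReal_of_nonpos (not_lt.1 hc)] at hlc
  refine lt_of_le_of_lt (sInf_le ⟨c, ⟨hc, le_trans (measure_mono ?_) h⟩, rfl⟩) hcm
  rintro s ⟨hs, hcs⟩
  exact ⟨hs, hlc.trans ((ENNReal.ofReal_lt_ofReal_iff (hc.trans hcs)).2 hcs)⟩

theorem volume_le_of_rearr_lt {I : Set ℝ} {x : ℝ → ℝ} {t : ℝ} {l : ℝ≥0∞}
    (h : rearr I x t < l) :
    volume {s : ℝ | s ∈ I ∧ l ≤ ENNReal.ofReal |x s|} ≤ ENNReal.ofReal t := by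
  obtain ⟨_, ⟨c, ⟨hc, hv⟩, rfl⟩, hcl⟩ := sInf_lt_iff.1 h
  refine le_trans (measure_mono ?_) hv
  rintro s ⟨hs, hls⟩
  exact ⟨hs, (ENNReal.ofReal_lt_ofReal_iff_of_nonneg hc.le).1 (hcl.trans_le hls)⟩

theorem rearr_antitone (I : Set ℝ) (x : ℝ → ℝ) : Antitone (rearr I x) := by
  intro t u htu
  refine sInf_le_sInf (image_mono ?_)
  rintro c ⟨hc, hv⟩
  exact ⟨hc, hv.trans (ENNReal.ofReal_le_ofReal htu)⟩

theorem rearr_mul_le {I : Set ℝ} {x y : ℝ → ℝ} {t : ℝ} (ht : 0 ≤ t)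
    (hx : rearr I x t ≠ ⊤) (hy : rearr I y t ≠ ⊤) :
    rearr I (fun s => x s * y s) (2 * t) ≤ rearr I x t * rearr I y t := by
  refine ENNReal.le_mul_of_forall_lt (Or.inr hy) (Or.inl hx) fun l hl m hm => ?_
  refine rearr_le_of_volume_le ?_
  calc volume {s : ℝ | s ∈ I ∧ l * m < ENNReal.ofReal |x s * y s|}
      ≤ volume ({s : ℝ | s ∈ I ∧ l ≤ ENNReal.ofReal |x s|} ∪
          {s : ℝ | s ∈ I ∧ m ≤ ENNReal.ofReal |y s|}) := by
        refine measure_mono ?_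
        rintro s ⟨hs, h⟩
        by_contra hn
        simp only [mem_union, mem_ofPred_eq, hs, true_and, not_or, not_le] at hn
        rw [abs_mul, ENNReal.ofReal_mul (abs_nonneg _)] at h
        exact absurd h (not_lt.2 (mul_le_mul' hn.1.le hn.2.le))
    _ ≤ ENNReal.ofReal t + ENNReal.ofReal t :=
        (measure_union_le _ _).trans
          (add_le_add (volume_le_of_rearr_lt hl) (volume_le_of_rearr_lt hm))
    _ = ENNReal.ofReal (2 * t) := by rw [← ENNReal.ofReal_add ht ht, two_mul]

/-- A pointwise form of Young's inequality, without the sharp constants. -/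
theorem mul_rpow_le_rpow_add_rpow {p q s : ℝ} (hp : 0 < p) (hq : 0 < q) (hs : 0 < s)
    (h : 1 / s = 1 / q - 1 / p) (X Y : ℝ≥0∞) : (X * Y) ^ q ≤ X ^ s + Y ^ p := by
  set M := max (X ^ s) (Y ^ p) with hM
  have hX : X ≤ M ^ (1 / s) := by
    rw [one_div, ENNReal.le_rpow_inv_iff hs]; exact le_max_left _ _
  have hY : Y ≤ M ^ (1 / p) := by
    rw [one_div, ENNReal.le_rpow_inv_iff hp]; exact le_max_right _ _
  calc (X * Y) ^ q ≤ (M ^ (1 / s) * M ^ (1 / p)) ^ q := by gcongr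
    _ = M := by
      rw [← ENNReal.rpow_add_of_nonneg _ _ (by positivity) (by positivity), h, sub_add_cancel,
        one_div, ENNReal.rpow_inv_rpow hq.ne']
    _ ≤ X ^ s + Y ^ p := max_le le_self_add le_add_self

theorem setLIntegral_Ioi_eq_two_mul (f : ℝ → ℝ≥0∞) :
    ∫⁻ t in Ioi (0 : ℝ), f t = 2 * ∫⁻ t in Ioi (0 : ℝ), f (2 * t) := by
  have himg : (fun t : ℝ => 2 * t) '' Ioi 0 = Ioi 0 := by
    rw [image_mul_left_Ioi (by norm_num : (0 : ℝ) < 2), mul_zero]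
  have h := lintegral_image_eq_lintegral_abs_deriv_mul (f' := fun _ => (2 : ℝ))
    (measurableSet_Ioi : MeasurableSet (Ioi (0 : ℝ)))
    (fun t _ => by simpa using ((hasDerivAt_id t).const_mul (2 : ℝ)).hasDerivWithinAt)
    (mul_right_injective₀ (two_ne_zero : (2 : ℝ) ≠ 0)).injOn f
  rw [himg] at h
  rw [h, ← lintegral_const_mul' _ _ (by simp)]
  simp

theorem ofReal_rpow_mul {t : ℝ} (ht : 0 < t) (c r : ℝ) :
    ENNReal.ofReal (t ^ (c * r)) = ENNReal.ofReal (t ^ c) ^ r := by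
  rw [Real.rpow_mul ht.le, ENNReal.ofReal_rpow_of_pos (Real.rpow_pos_of_pos ht c)]

theorem ae_rearr_ne_top {x : ℝ → ℝ} {p : ℝ} (hp : 0 < p) {c : ℝ}
    (h : ∫⁻ t in Ioi (0 : ℝ), rearr (Ioi 0) x t ^ p * ENNReal.ofReal (t ^ c) < ⊤) :
    ∀ᵐ t ∂(volume.restrict (Ioi (0 : ℝ))), rearr (Ioi 0) x t ≠ ⊤ := by
  have hm := (rearr_antitone (Ioi 0) x).measurable
  filter_upwards [ae_lt_top (by fun_prop) h.ne, ae_restrict_mem measurableSet_Ioi]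
    with t ht ht0 htop
  have : ENNReal.ofReal (t ^ c) ≠ 0 := by simpa using Real.rpow_pos_of_pos ht0 c
  simp [htop, ENNReal.top_rpow_of_pos hp, ENNReal.top_mul this] at ht

theorem lambdaMem_mul {p q s a b : ℝ} (hp : 0 < p) (hq : 0 < q) (hs : 0 < s)
    (h : 1 / s = 1 / q - 1 / p) {x y : ℝ → ℝ}
    (hx : lambdaMem s (fun t => t ^ ((b - a) * s)) x)
    (hy : lambdaMem p (fun t => t ^ (a * p)) y) :
    lambdaMem q (fun t => t ^ (b * q)) (fun t => x t * y t) := by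
  have hmx := (rearr_antitone (Ioi 0) x).measurable
  have hsum := ENNReal.add_lt_top.2 ⟨hx, hy⟩
  rw [← lintegral_add_left (by fun_prop)] at hsum
  unfold lambdaMem
  rw [setLIntegral_Ioi_eq_two_mul]
  refine ENNReal.mul_lt_top (by simp) (lt_of_le_of_lt ?_
    (ENNReal.mul_lt_top (ENNReal.ofReal_lt_top (r := 2 ^ (b * q))) hsum))
  rw [← lintegral_const_mul' _ _ ENNReal.ofReal_ne_top]
  refine lintegral_mono_ae ?_
  filter_upwards [ae_rearr_ne_top hs hx, ae_rearr_ne_top hp hy, ae_restrict_mem measurableSet_Ioi]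
    with t hxt hyt (ht : 0 < t)
  have hw : ENNReal.ofReal ((2 * t) ^ (b * q)) = ENNReal.ofReal (2 ^ (b * q)) *
      (ENNReal.ofReal (t ^ (b - a)) * ENNReal.ofReal (t ^ a)) ^ q := by
    rw [Real.mul_rpow zero_le_two ht.le, ENNReal.ofReal_mul (by positivity), ofReal_rpow_mul ht b q,
      ← ENNReal.ofReal_mul (by positivity), ← Real.rpow_add ht, sub_add_cancel]
  simp only [hw, ofReal_rpow_mul ht]
  rw [← ENNReal.mul_rpow_of_nonneg _ _ hs.le, ← ENNReal.mul_rpow_of_nonneg _ _ hp.le,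
    mul_left_comm]
  refine mul_le_mul_right (le_trans ?_ (mul_rpow_le_rpow_add_rpow hp hq hs h _ _)) _
  rw [mul_mul_mul_comm, ENNReal.mul_rpow_of_nonneg (rearr (Ioi 0) x t * _) _ hq.le]
  exact mul_le_mul_left (ENNReal.rpow_le_rpow (rearr_mul_le ht.le hxt hyt) hq.le) _

theorem exists_tsum_mul_rpow_eq_top {ι : Type*} {f : ι → ℝ≥0∞} (hf : ∀ i, f i ≠ ⊤)
    (hsum : ∑' i, f i = ⊤) {θ : ℝ} (h0 : 0 < θ) (h1 : θ < 1) :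
    ∃ g : ι → ℝ≥0∞, ∑' i, f i * g i ≠ ⊤ ∧ ∑' i, f i * g i ^ θ = ⊤ := by
  classical
  have h1' : 0 < 1 - θ := by linarith
  have key : ∀ n : ℕ, ∃ F : Finset ι,
      (((n : ℝ≥0∞) + 1) * (2 ^ n) ^ θ) ^ (1 - θ)⁻¹ < ∑ i ∈ F, f i := fun n => by
    refine lt_iSup_iff.1 ?_
    rw [← ENNReal.tsum_eq_iSup_sum, hsum]
    refine ENNReal.rpow_lt_top_of_nonneg (by positivity) (ENNReal.mul_ne_top (by simp) ?_)
    exact ENNReal.rpow_ne_top_of_nonneg h0.le (by simp)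
  choose F hF using key
  set T : ℕ → ℝ≥0∞ := fun n => ∑ i ∈ F n, f i with hT
  have hT0 : ∀ n, T n ≠ 0 := fun n => (bot_le.trans_lt (hF n)).ne'
  have hTt : ∀ n, T n ≠ ⊤ := fun n => (ENNReal.sum_lt_top.2 fun i _ => (hf i).lt_top).ne
  refine ⟨fun i => ∑' n, if i ∈ F n then (2 ^ n)⁻¹ * (T n)⁻¹ else 0, ?_, ?_⟩
  · simp_rw [← ENNReal.tsum_mul_left]
    rw [ENNReal.tsum_comm]
    have : ∀ n, ∑' i, f i * (if i ∈ F n then (2 ^ n)⁻¹ * (T n)⁻¹ else 0) = 2⁻¹ ^ n := fun n => by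
      rw [tsum_eq_sum (s := F n) (fun i hi => by simp [hi]),
        Finset.sum_congr rfl (fun i hi => by rw [if_pos hi]), ← Finset.sum_mul]
      change T n * _ = _
      rw [mul_left_comm, ENNReal.mul_inv_cancel (hT0 n) (hTt n), mul_one, ENNReal.inv_pow]
    simp_rw [this, ENNReal.tsum_geometric]
    simp
  · refine ENNReal.eq_top_of_forall_nnreal_le fun r => ?_
    obtain ⟨n, hn⟩ := exists_nat_gt r
    have hn' : (r : ℝ≥0∞) ≤ n + 1 := by
      calc (r : ℝ≥0∞) ≤ n := by exact_mod_cast hn.le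
        _ ≤ n + 1 := le_self_add
    have hc : ((n : ℝ≥0∞) + 1) * (2 ^ n) ^ θ ≤ T n ^ (1 - θ) := by
      have := (hF n).le
      rwa [← ENNReal.le_rpow_inv_iff (inv_pos.2 h1'), inv_inv] at this
    calc (r : ℝ≥0∞) ≤ (n + 1) * (2 ^ n) ^ θ * ((2 ^ n)⁻¹) ^ θ := by
          rw [mul_assoc, ← ENNReal.mul_rpow_of_nonneg _ _ h0.le,
            ENNReal.mul_inv_cancel (by simp) (by simp), ENNReal.one_rpow, mul_one]
          exact hn'
      _ ≤ T n ^ (1 - θ) * ((2 ^ n)⁻¹) ^ θ := by gcongr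
      _ = T n * ((2 ^ n)⁻¹ * (T n)⁻¹) ^ θ := by
          rw [ENNReal.mul_rpow_of_nonneg _ _ h0.le, ENNReal.rpow_sub _ _ (hT0 n) (hTt n),
            ENNReal.rpow_one, ENNReal.inv_rpow (T n), div_eq_mul_inv]
          ring
      _ = ∑ i ∈ F n, f i * ((2 ^ n)⁻¹ * (T n)⁻¹) ^ θ := by rw [← Finset.sum_mul]
      _ ≤ ∑ i ∈ F n, f i * (∑' n, if i ∈ F n then (2 ^ n)⁻¹ * (T n)⁻¹ else 0) ^ θ := by
          refine Finset.sum_le_sum fun i hi => ?_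
          gcongr
          exact le_trans (by rw [if_pos hi]) (ENNReal.le_tsum n)
      _ ≤ _ := ENNReal.sum_le_tsum _

theorem exists_measurable_subset_volume_eq {A : Set ℝ} (hA : MeasurableSet A) (hA0 : A ⊆ Ioi 0)
    {r : ℝ} (hr : 0 ≤ r) (h : ENNReal.ofReal r < volume A) :
    ∃ E ⊆ A, MeasurableSet E ∧ volume E = ENNReal.ofReal r := by
  have hfin : ∀ u : ℝ, volume (A ∩ Iio u) ≠ ⊤ := fun u =>
    (lt_of_le_of_lt (measure_mono (t := Ioo 0 u) fun z hz => ⟨hA0 hz.1, hz.2⟩) (by simp)).ne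
  have hU : A = ⋃ n : ℕ, A ∩ Iio (n : ℝ) := by
    rw [← inter_iUnion, eq_comm, inter_eq_left]
    intro z _
    exact mem_iUnion.2 (exists_nat_gt z)
  have hmono : Monotone fun n : ℕ => A ∩ Iio (n : ℝ) := fun m n hmn =>
    inter_subset_inter_right _ (Iio_subset_Iio (by exact_mod_cast hmn))
  rw [hU, hmono.measure_iUnion] at h
  obtain ⟨n, hn⟩ := lt_iSup_iff.1 h
  set φ : ℝ → ℝ := fun u => (volume (A ∩ Iio u)).toReal with hφ
  have hlip : LipschitzWith 1 φ := by
    refine LipschitzWith.of_le_add fun u v => ?_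
    have : volume (A ∩ Iio u) ≤ volume (A ∩ Iio v) + ENNReal.ofReal (dist u v) := by
      refine (measure_mono (t := (A ∩ Iio v) ∪ Ico v u) fun z hz => ?_).trans
        ((measure_union_le _ _).trans (add_le_add le_rfl ?_))
      · rcases lt_or_ge z v with hzv | hzv
        · exact Or.inl ⟨hz.1, hzv⟩
        · exact Or.inr ⟨hzv, hz.2⟩
      · rw [Real.volume_Ico]
        exact ENNReal.ofReal_le_ofReal (le_abs_self _)
    have h2 := ENNReal.toReal_mono (by simp [hfin]) this
    rwa [ENNReal.toReal_add (hfin v) (by simp), ENNReal.toReal_ofReal dist_nonneg] at h2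
  have h0 : φ 0 = 0 := by
    have : A ∩ Iio 0 = ∅ := eq_empty_of_forall_notMem fun z hz => lt_asymm (mem_Ioi.1 (hA0 hz.1)) (mem_Iio.1 hz.2)
    simp [hφ, this]
  have hrn : r ≤ φ n := (ENNReal.ofReal_le_iff_le_toReal (hfin n)).1 hn.le
  obtain ⟨u, -, hu⟩ := intermediate_value_Icc (Nat.cast_nonneg n) hlip.continuous.continuousOn
    ⟨h0.trans_le hr, hrn⟩
  exact ⟨A ∩ Iio u, inter_subset_left, hA.inter measurableSet_Iio,
    by rw [← hu, ENNReal.ofReal_toReal (hfin u)]⟩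

theorem ofReal_two_zpow (k : ℤ) : ENNReal.ofReal ((2 : ℝ) ^ k) = (2 : ℝ≥0∞) ^ (k : ℝ) := by
  rw [← Real.rpow_intCast, ← ENNReal.ofReal_rpow_of_pos two_pos, ENNReal.ofReal_ofNat]

theorem two_rpow_add (u v : ℝ) : (2 : ℝ≥0∞) ^ (u + v) = 2 ^ u * 2 ^ v :=
  ENNReal.rpow_add _ _ two_ne_zero ENNReal.ofNat_ne_top

theorem two_rpow_ne_top (u : ℝ) : (2 : ℝ≥0∞) ^ u ≠ ⊤ := by simp

theorem two_rpow_ne_zero (u : ℝ) : (2 : ℝ≥0∞) ^ u ≠ 0 := by simp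

theorem iUnion_Ico_two_zpow : ⋃ k : ℤ, Ico ((2 : ℝ) ^ k) (2 ^ (k + 1)) = Ioi 0 := by
  ext t
  simp only [mem_iUnion, mem_Ioi]
  exact ⟨fun ⟨k, hk⟩ => (zpow_pos two_pos k).trans_le hk.1,
    fun ht => exists_mem_Ico_zpow ht one_lt_two⟩

theorem lintegral_Ioi_eq_tsum_dyadic (f : ℝ → ℝ≥0∞) :
    ∫⁻ t in Ioi (0 : ℝ), f t = ∑' k : ℤ, ∫⁻ t in Ico ((2 : ℝ) ^ k) (2 ^ (k + 1)), f t := by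
  rw [← iUnion_Ico_two_zpow, lintegral_iUnion (fun _ => measurableSet_Ico)]
  exact (zpow_right_mono₀ (one_le_two (α := ℝ))).pairwise_disjoint_on_Ico_succ

theorem volume_Ico_two_zpow (k : ℤ) :
    volume (Ico ((2 : ℝ) ^ k) (2 ^ (k + 1))) = 2 ^ (k : ℝ) := by
  rw [Real.volume_Ico, zpow_add_one₀ two_ne_zero, ← ofReal_two_zpow]
  congr 1
  ring

theorem ofReal_rpow_dyadic {k : ℤ} {t : ℝ} (ht : t ∈ Ico ((2 : ℝ) ^ k) (2 ^ (k + 1))) (c : ℝ) :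
    ENNReal.ofReal (t ^ c) ≤ 2 ^ |c| * 2 ^ (k * c) ∧
      (2 : ℝ≥0∞) ^ (k * c) ≤ 2 ^ |c| * ENNReal.ofReal (t ^ c) := by
  have ht0 : 0 < t := (zpow_pos two_pos k).trans_le ht.1
  obtain ⟨l, rfl⟩ : ∃ l : ℝ, (2 : ℝ) ^ l = t :=
    ⟨Real.logb 2 t, Real.rpow_logb two_pos (by norm_num) ht0⟩
  rw [mem_Ico, ← Real.rpow_intCast, ← Real.rpow_intCast,
    Real.rpow_le_rpow_left_iff one_lt_two, Real.rpow_lt_rpow_left_iff one_lt_two] at ht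
  push_cast at ht
  have hl : |(l - k) * c| ≤ |c| := by
    rw [abs_mul]
    refine mul_le_of_le_one_left (abs_nonneg c) ?_
    rw [abs_le]
    constructor <;> linarith [ht.1, ht.2]
  rw [abs_le] at hl
  have h2 : ENNReal.ofReal (((2 : ℝ) ^ l) ^ c) = 2 ^ (l * c) := by
    rw [← Real.rpow_mul zero_le_two, ← ENNReal.ofReal_rpow_of_pos two_pos, ENNReal.ofReal_ofNat]
  rw [h2, ← two_rpow_add, ← two_rpow_add]
  constructor <;> refine ENNReal.rpow_le_rpow_of_exponent_le one_le_two ?_ <;> nlinarith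

theorem lintegral_Ioi_le_tsum_dyadic {F : ℝ → ℝ≥0∞} {h : ℤ → ℝ≥0∞}
    (hF : ∀ k : ℤ, ∀ t ∈ Ico ((2 : ℝ) ^ k) (2 ^ (k + 1)), F t ≤ h k) (c : ℝ) :
    ∫⁻ t in Ioi (0 : ℝ), F t * ENNReal.ofReal (t ^ c) ≤
      2 ^ |c| * ∑' k : ℤ, h k * 2 ^ (k * (c + 1)) := by
  rw [lintegral_Ioi_eq_tsum_dyadic, ← ENNReal.tsum_mul_left]
  refine ENNReal.tsum_le_tsum fun k => ?_
  calc ∫⁻ t in Ico ((2 : ℝ) ^ k) (2 ^ (k + 1)), F t * ENNReal.ofReal (t ^ c)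
      ≤ ∫⁻ _ in Ico ((2 : ℝ) ^ k) (2 ^ (k + 1)), h k * (2 ^ |c| * 2 ^ (k * c)) :=
        setLIntegral_mono' measurableSet_Ico fun t ht =>
          mul_le_mul' (hF k t ht) (ofReal_rpow_dyadic ht c).1
    _ = 2 ^ |c| * (h k * 2 ^ (k * (c + 1))) := by
        rw [setLIntegral_const, volume_Ico_two_zpow, mul_add, mul_one, two_rpow_add]
        ring

theorem tsum_dyadic_le_lintegral_Ioi {F : ℝ → ℝ≥0∞} {h : ℤ → ℝ≥0∞}
    (hF : ∀ k : ℤ, ∀ t ∈ Ico ((2 : ℝ) ^ k) (2 ^ (k + 1)), h k ≤ F t) (c : ℝ) :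
    ∑' k : ℤ, h k * 2 ^ (k * (c + 1)) ≤
      2 ^ |c| * ∫⁻ t in Ioi (0 : ℝ), F t * ENNReal.ofReal (t ^ c) := by
  rw [lintegral_Ioi_eq_tsum_dyadic, ← ENNReal.tsum_mul_left]
  refine ENNReal.tsum_le_tsum fun k => ?_
  calc h k * 2 ^ (k * (c + 1))
      = ∫⁻ _ in Ico ((2 : ℝ) ^ k) (2 ^ (k + 1)), h k * 2 ^ (k * c) := by
        rw [setLIntegral_const, volume_Ico_two_zpow, mul_add, mul_one, two_rpow_add]
        ring
    _ ≤ ∫⁻ t in Ico ((2 : ℝ) ^ k) (2 ^ (k + 1)), 2 ^ |c| * (F t * ENNReal.ofReal (t ^ c)) :=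
        setLIntegral_mono' measurableSet_Ico fun t ht => by
          rw [mul_left_comm]
          exact mul_le_mul' (hF k t ht) (ofReal_rpow_dyadic ht c).2
    _ = _ := lintegral_const_mul' _ _ (two_rpow_ne_top _)

/-- A function whose rearrangement is controlled by a decreasing sequence `c` on dyadic points,
and which is at least `c k` on prescribed sets `E k` of measure at most `2 ^ k`. -/
theorem exists_rearr_le_of_volume_le {E : ℤ → Set ℝ} (hE : ∀ k, MeasurableSet (E k))
    (hvol : ∀ k, volume (E k) ≤ 2 ^ (k : ℝ)) {c : ℤ → ℝ≥0∞} (hc : Antitone c)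
    (hct : ∀ k, c k ≠ ⊤) :
    ∃ y : ℝ → ℝ, Measurable y ∧ (∀ k : ℤ, rearr (Ioi 0) y (2 ^ k) ≤ c k) ∧
      ∀ k, ∀ᵐ t, t ∈ E k → c k ≤ ENNReal.ofReal |y t| := by
  set Y : ℝ → ℝ≥0∞ := fun t => ⨆ k, (E k).indicator (fun _ => c k) t with hY
  have hYm : Measurable Y := Measurable.iSup fun k => measurable_const.indicator (hE k)
  have hlt : ∀ K : ℤ, volume {t | c K < Y t} ≤ 2 ^ (K : ℝ) := fun K => by
    have hsub : {t | c K < Y t} ⊆ ⋃ n : ℕ, E (K - 1 - n) := fun t ht => by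
      obtain ⟨k, hk⟩ := lt_iSup_iff.1 (show c K < Y t from ht)
      by_cases htk : t ∈ E k
      · rw [indicator_of_mem htk] at hk
        have hkK : k < K := lt_of_not_ge fun h => absurd hk (not_lt.2 (hc h))
        refine mem_iUnion.2 ⟨(K - 1 - k).toNat, ?_⟩
        rwa [Int.toNat_of_nonneg (by omega), sub_sub_cancel]
      · simp [indicator_of_notMem htk] at hk
    calc volume {t | c K < Y t} ≤ ∑' n : ℕ, volume (E (K - 1 - n)) :=
          (measure_mono hsub).trans (measure_iUnion_le _)
      _ ≤ ∑' n : ℕ, 2 ^ ((K : ℝ) - 1) * 2⁻¹ ^ n := by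
          refine ENNReal.tsum_le_tsum fun n => (hvol _).trans_eq ?_
          push_cast
          rw [sub_eq_add_neg _ (n : ℝ), two_rpow_add, ENNReal.rpow_neg, ENNReal.rpow_natCast,
            ENNReal.inv_pow]
      _ = 2 ^ (K : ℝ) := by
          rw [ENNReal.tsum_mul_left, ENNReal.tsum_geometric, ENNReal.one_sub_inv_two, inv_inv]
          conv_rhs => rw [← sub_add_cancel (K : ℝ) 1, two_rpow_add, ENNReal.rpow_one]
  have htop : ∀ᵐ t, Y t ≠ ⊤ := by
    rw [ae_iff]
    have hle : ∀ n : ℕ, volume {t | ¬ Y t ≠ ⊤} ≤ 2⁻¹ ^ n := fun n => by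
      refine (measure_mono fun t ht => ?_).trans ((hlt (-n)).trans_eq ?_)
      · simp only [ne_eq, not_not, mem_ofPred_eq] at ht ⊢
        exact ht ▸ (hct _).lt_top
      · push_cast
        rw [ENNReal.rpow_neg, ENNReal.rpow_natCast, ENNReal.inv_pow]
    refine le_antisymm (ge_of_tendsto' (ENNReal.tendsto_pow_atTop_nhds_zero_of_lt_one ?_) hle)
      bot_le
    simp
  refine ⟨fun t => (Y t).toReal, hYm.ennreal_toReal, fun K => ?_, fun k => ?_⟩
  · refine rearr_le_of_volume_le ?_
    rw [ofReal_two_zpow]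
    refine (measure_mono ?_).trans (hlt K)
    rintro t ⟨-, ht⟩
    rw [abs_of_nonneg ENNReal.toReal_nonneg] at ht
    exact ht.trans_le ENNReal.ofReal_toReal_le
  · filter_upwards [htop] with t ht htk
    rw [abs_of_nonneg ENNReal.toReal_nonneg, ENNReal.ofReal_toReal ht]
    refine le_iSup_of_le k ?_
    rw [indicator_of_mem htk]

theorem exists_dyadic_lt_rearr {x : ℝ → ℝ} {s : ℝ} (hs : 0 < s) {c : ℝ}
    (h : ∫⁻ t in Ioi (0 : ℝ), rearr (Ioi 0) x t ^ s * ENNReal.ofReal (t ^ c) = ⊤) :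
    ∃ X : ℤ → ℝ≥0∞, (∀ k, X k ≠ ⊤) ∧ (∀ k : ℤ, X k = 0 ∨ X k < rearr (Ioi 0) x (2 ^ k)) ∧
      ∑' k : ℤ, X k ^ s * 2 ^ (k * (c + 1)) = ⊤ := by
  by_cases htop : ∃ k₀ : ℤ, rearr (Ioi 0) x (2 ^ k₀) = ⊤
  · obtain ⟨k₀, hk₀⟩ := htop
    refine ⟨fun k => if k ≤ k₀ then 2 ^ (-(k * (c + 1)) / s) else 0, fun k => ?_, fun k => ?_, ?_⟩
    · dsimp only
      split_ifs <;> simp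
    · dsimp only
      split_ifs with hk
      · right
        have : rearr (Ioi 0) x (2 ^ k) = ⊤ := top_le_iff.1
          (hk₀.ge.trans (rearr_antitone _ _ (zpow_le_zpow_right₀ one_le_two hk)))
        rw [this]
        exact (two_rpow_ne_top _).lt_top
      · exact Or.inl rfl
    · have hinj : Function.Injective fun n : ℕ => k₀ - (n : ℤ) := fun m n hmn => by
        simpa using hmn
      refine top_le_iff.1 (le_trans ?_ (ENNReal.tsum_comp_le_tsum_of_injective hinj _))
      rw [← ENNReal.tsum_const_eq_top_of_ne_zero (α := ℕ) (one_ne_zero (α := ℝ≥0∞))]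
      refine ENNReal.tsum_le_tsum fun n => ?_
      dsimp only
      rw [if_pos (by omega), ← ENNReal.rpow_mul, div_mul_cancel₀ _ hs.ne', ← two_rpow_add,
        neg_add_cancel, ENNReal.rpow_zero]
  · push Not at htop
    refine ⟨fun k => rearr (Ioi 0) x (2 ^ k) / 2, fun k => ENNReal.div_ne_top (htop k) (by simp),
      fun k => ?_, ?_⟩
    · rcases eq_or_ne (rearr (Ioi 0) x (2 ^ k)) 0 with h0 | h0
      · simp [h0]
      · exact Or.inr (ENNReal.half_lt_self h0 (htop k))
    · have hle := lintegral_Ioi_le_tsum_dyadic (F := fun t => rearr (Ioi 0) x t ^ s)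
        (h := fun k => rearr (Ioi 0) x (2 ^ k) ^ s)
        (fun k t ht => ENNReal.rpow_le_rpow (rearr_antitone _ _ ht.1) hs.le) c
      rw [h, top_le_iff] at hle
      have hsum := (ENNReal.mul_eq_top.1 hle).resolve_right fun h => two_rpow_ne_top _ h.1
      simp_rw [ENNReal.div_rpow_of_nonneg _ _ hs.le, div_eq_mul_inv, mul_right_comm _ ((2 : ℝ≥0∞) ^ s)⁻¹]
      rw [ENNReal.tsum_mul_right, hsum.2]
      exact ENNReal.top_mul (ENNReal.inv_ne_zero.2 (two_rpow_ne_top _))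

theorem not_forall_lambdaMem_mul {p q s a b : ℝ} (hp : 0 < p) (hq : 0 < q) (hs : 0 < s)
    (h : 1 / s = 1 / q - 1 / p) (ha : -(1 / p) < a) {x : ℝ → ℝ} (hx : Measurable x)
    (hint : ∫⁻ t in Ioi (0 : ℝ), rearr (Ioi 0) x t ^ s * ENNReal.ofReal (t ^ ((b - a) * s)) = ⊤) :
    ∃ y : ℝ → ℝ, Measurable y ∧ lambdaMem p (fun t => t ^ (a * p)) y ∧
      ¬ lambdaMem q (fun t => t ^ (b * q)) (fun t => x t * y t) := by
  obtain ⟨X, hXt, hX, hXsum⟩ := exists_dyadic_lt_rearr hs hint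
  set A : ℤ → ℝ≥0∞ := fun k => X k ^ s * 2 ^ (k * ((b - a) * s + 1)) with hA
  have hAt : ∀ k, A k ≠ ⊤ := fun k =>
    ENNReal.mul_ne_top (ENNReal.rpow_ne_top_of_nonneg hs.le (hXt k)) (two_rpow_ne_top _)
  have hqp : q / p = 1 - q / s := by
    rw [div_eq_mul_one_div q s, h]
    field_simp
    ring
  obtain ⟨g, hg, hgtop⟩ := exists_tsum_mul_rpow_eq_top hAt hXsum (div_pos hq hp)
    (by rw [hqp]; linarith [div_pos hq hs])
  set σ : ℝ := a * p + 1 with hσ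
  have hσ0 : 0 < σ := by
    have := mul_lt_mul_of_pos_right ha hp
    rw [neg_mul, one_div_mul_cancel hp.ne'] at this
    linarith
  set f : ℤ → ℝ≥0∞ := fun k => A k * g k * 2 ^ (-(k * σ)) with hf
  set d : ℤ → ℝ≥0∞ := fun k => ∑' n : ℕ, f (k + n) with hd
  have hfd : ∀ k, f k ≤ d k := fun k => by
    simpa using ENNReal.le_tsum (f := fun n : ℕ => f (k + n)) 0
  have hdanti : Antitone d := antitone_int_of_succ_le fun k => by
    have := ENNReal.tsum_comp_le_tsum_of_injective (add_left_injective 1)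
      (fun n : ℕ => f (k + n))
    refine le_of_eq_of_le (tsum_congr fun n => ?_) this
    push_cast
    ring_nf
  have hdsum : ∑' k : ℤ, d k * 2 ^ (k * σ) ≠ ⊤ := by
    have : ∑' k : ℤ, d k * 2 ^ (k * σ) = (∑' n : ℕ, ((2 : ℝ≥0∞) ^ (-σ)) ^ n) * ∑' k, A k * g k := by
      simp_rw [hd, ← ENNReal.tsum_mul_right]
      rw [ENNReal.tsum_comm]
      refine tsum_congr fun n => ?_
      rw [← (Equiv.addRight (n : ℤ)).tsum_eq fun k => A k * g k, ← ENNReal.tsum_mul_left]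
      refine tsum_congr fun k => ?_
      simp only [Equiv.coe_addRight, hf]
      rw [mul_assoc, ← two_rpow_add, mul_comm, ← ENNReal.rpow_natCast, ← ENNReal.rpow_mul]
      congr 2
      push_cast
      ring
    rw [this, ENNReal.tsum_geometric]
    refine ENNReal.mul_ne_top (ENNReal.inv_ne_top.2 (tsub_pos_of_lt ?_).ne') hg
    exact ENNReal.rpow_lt_one_of_one_lt_of_neg ENNReal.one_lt_two (by linarith)
  have hdt : ∀ k, d k ≠ ⊤ := fun k hk => by
    refine hdsum (top_le_iff.1 (le_trans (le_of_eq ?_) (ENNReal.le_tsum k)))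
    rw [hk, ENNReal.top_mul (two_rpow_ne_zero _)]
  have hE : ∀ k : ℤ, ∃ E ⊆ {t | t ∈ Ioi (0 : ℝ) ∧ X k < ENNReal.ofReal |x t|},
      MeasurableSet E ∧ volume E ≤ 2 ^ (k : ℝ) ∧ (X k = 0 ∨ volume E = 2 ^ (k : ℝ)) := fun k => by
    rcases hX k with h0 | hlt
    · exact ⟨∅, empty_subset _, MeasurableSet.empty, by simp, Or.inl h0⟩
    · obtain ⟨E, hEs, hEm, hEv⟩ := exists_measurable_subset_volume_eq
        (measurableSet_Ioi.inter (measurableSet_lt measurable_const hx.abs.ennreal_ofReal))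
        inter_subset_left (zpow_nonneg zero_le_two k)
        (lt_of_not_ge fun hv => absurd hlt (not_lt.2 (rearr_le_of_volume_le hv)))
      rw [ofReal_two_zpow] at hEv
      exact ⟨E, hEs, hEm, hEv.le, Or.inr hEv⟩
  choose E hEs hEm hEv hEv' using hE
  obtain ⟨y, hym, hyr, hyE⟩ := exists_rearr_le_of_volume_le hEm hEv
    (c := fun k => d k ^ (1 / p))
    (fun k l hkl => ENNReal.rpow_le_rpow (hdanti hkl) (by positivity))
    (fun k => ENNReal.rpow_ne_top_of_nonneg (by positivity) (hdt k))
  refine ⟨y, hym, ?_, fun hmem => ?_⟩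
  · refine lt_of_le_of_lt (lintegral_Ioi_le_tsum_dyadic (h := d) (fun k t ht => ?_) (a * p))
      (ENNReal.mul_lt_top (two_rpow_ne_top _).lt_top hdsum.lt_top)
    calc rearr (Ioi 0) y t ^ p ≤ (d k ^ (1 / p)) ^ p :=
          ENNReal.rpow_le_rpow ((rearr_antitone _ _ ht.1).trans (hyr k)) hp.le
      _ = d k := by rw [one_div, ENNReal.rpow_inv_rpow hp.ne']
  · have hlow : ∀ k : ℤ, ∀ t < (2 : ℝ) ^ k,
        X k * d k ^ (1 / p) ≤ rearr (Ioi 0) (fun t => x t * y t) t := fun k t ht => by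
      rcases hEv' k with h0 | hv
      · simp [h0]
      · by_contra! hlt
        refine absurd (volume_le_of_rearr_lt hlt) (not_le.2 ?_)
        calc ENNReal.ofReal t < ENNReal.ofReal (2 ^ k) :=
              (ENNReal.ofReal_lt_ofReal_iff (zpow_pos two_pos k)).2 ht
          _ = volume (E k) := by rw [hv, ofReal_two_zpow]
          _ ≤ _ := by
              refine measure_mono_ae ?_
              filter_upwards [hyE k] with u hu huE
              refine ⟨(hEs k huE).1, ?_⟩
              rw [abs_mul, ENNReal.ofReal_mul (abs_nonneg _)]
              exact mul_le_mul' (hEs k huE).2.le (hu huE)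
    have hsum := tsum_dyadic_le_lintegral_Ioi (F := fun t => rearr (Ioi 0) (fun t => x t * y t) t ^ q)
      (h := fun k => (X (k + 1) * d (k + 1) ^ (1 / p)) ^ q)
      (fun k t ht => ENNReal.rpow_le_rpow (hlow (k + 1) t ht.2) hq.le) (b * q)
    have hfin := hsum.trans_lt (ENNReal.mul_lt_top (two_rpow_ne_top _).lt_top hmem)
    refine (ENNReal.mul_lt_top (two_rpow_ne_top (b * q + 1)).lt_top hfin).ne (top_le_iff.1 ?_)
    rw [← hgtop, ← ENNReal.tsum_mul_left, ← (Equiv.addRight (1 : ℤ)).tsum_eq]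
    refine ENNReal.tsum_le_tsum fun k => ?_
    simp only [Equiv.coe_addRight]
    have hterm : ∀ k : ℤ, A k * g k ^ (q / p) =
        (X k * f k ^ (1 / p)) ^ q * 2 ^ (k * (b * q + 1)) := fun k => by
      have hθ : 0 < q / p := div_pos hq hp
      rw [ENNReal.mul_rpow_of_nonneg _ _ hq.le, ← ENNReal.rpow_mul, one_div_mul_eq_div]
      simp only [hf, hA]
      simp only [ENNReal.mul_rpow_of_nonneg _ _ hθ.le, ← ENNReal.rpow_mul]
      have e1 : X k ^ s = X k ^ q * X k ^ (s * (q / p)) := by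
        rw [← ENNReal.rpow_add_of_nonneg _ _ hq.le (by positivity), hqp]
        congr 1
        field_simp
        ring
      have e2 : (2 : ℝ≥0∞) ^ (k * ((b - a) * s + 1)) = 2 ^ (k * ((b - a) * s + 1) * (q / p)) *
          2 ^ (-(k * σ) * (q / p)) * 2 ^ (k * (b * q + 1)) := by
        rw [← two_rpow_add, ← two_rpow_add]
        congr 1
        have e3 : σ * (q / p) = a * q + q / p := by
          rw [hσ]
          field_simp
        have e4 : k * ((b - a) * s + 1) * (q / p) + -(k * σ) * (q / p) + k * (b * q + 1) =
          k * (((b - a) * s + 1) * (q / p) - σ * (q / p) + (b * q + 1)) := by ring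
        rw [e4, e3, hqp]
        field_simp
        ring
      rw [e1, e2]
      ring
    rw [hterm, mul_left_comm, ← two_rpow_add]
    have he : ((k + 1 : ℤ) : ℝ) * (b * q + 1) = b * q + 1 + k * (b * q + 1) := by
      push_cast
      ring
    rw [he]
    gcongr
    exact hfd _

/-- for `1 < q < p < ∞`, `−1/p < a < 1−1/p`, `−1/q < b < 1−1/q` and
`(b−a)·pq/(p−q) > −1`, with `1/s = 1/q − 1/p`, one has
`M(Λ_{p,t^{ap}}, Λ_{q,t^{bq}}) = Λ_{s,t^{(b−a)s}}`. -/
theorem stmt14 (p q : ℝ) (hq : 1 < q) (hqp : q < p)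
    (a b : ℝ) (ha₁ : -(1/p) < a) (ha₂ : a < 1 - 1/p)
    (hb₁ : -(1/q) < b) (hb₂ : b < 1 - 1/q)
    (hba : (b - a) * (p * q / (p - q)) > -1)
    (s : ℝ) (hs : 1/s = 1/q - 1/p)
    (x : ℝ → ℝ) (hx : Measurable x) :
    (∀ y : ℝ → ℝ, Measurable y →
        lambdaMem p (fun t => t ^ (a * p)) y →
        lambdaMem q (fun t => t ^ (b * q)) (fun t => x t * y t)) ↔
      (∫⁻ t in Ioi (0:ℝ),
          rearr (Ioi 0) x t ^ s * ENNReal.ofReal (t ^ ((b - a) * s))) < ⊤ := by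
  have hq0 : 0 < q := one_pos.trans hq
  have hp0 : 0 < p := hq0.trans hqp
  have hs0 : 0 < s := one_div_pos.1 (hs ▸ sub_pos.2 (one_div_lt_one_div_of_lt hq0 hqp))
  refine ⟨fun hmul => lt_top_iff_ne_top.2 fun htop => ?_,
    fun hint y _ hy => lambdaMem_mul hp0 hq0 hs0 hs hint hy⟩
  obtain ⟨y, hym, hy, hxy⟩ := not_forall_lambdaMem_mul hp0 hq0 hs0 hs ha₁ hx htop
  exact hxy (hmul y hym hy)
end

section
/- Let 1 < q ≤ p ≤ ∞ and define r by 1/r = 1/q − 1/p (r = ∞ when p = q). Then M(Ces_p(0,∞), Ces_q(0,∞)) = L̃^r(0,∞): a measurable x on (0,∞) satisfies x·y ∈ Ces_q(0,∞) for every y ∈ Ces_p(0,∞) if and only if x̃ ∈ L^r(0,∞). -/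
open MeasureTheory Set
open scoped ENNReal

/-- The Hardy operator `Hx(t) = (1/t)∫_0^t |x(s)| ds`, valued in `[0,∞]`. -/
noncomputable def hardyOp (x : ℝ → ℝ) (t : ℝ) : ℝ≥0∞ :=
  (ENNReal.ofReal t)⁻¹ * ∫⁻ s in Ioo (0:ℝ) t, ENNReal.ofReal |x s|

open Classical in
/-- The norm of the Cesàro space `Ces_p(0,∞) = {x : Hx ∈ L^p(0,∞)}`. -/
noncomputable def cesNorm (p : ℝ≥0∞) (x : ℝ → ℝ) : ℝ≥0∞ :=
  if p = ⊤ then essSup (fun t => hardyOp x t) (volume.restrict (Ioi 0))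
  else (∫⁻ t in Ioi (0:ℝ), hardyOp x t ^ p.toReal) ^ (p⁻¹).toReal

/-- `x ∈ Ces_p(0,∞)`. -/
def memCes (p : ℝ≥0∞) (x : ℝ → ℝ) : Prop := cesNorm p x ≠ ⊤

open Classical in
/-- The norm of the Tandori space `L̃^r(0,∞) = {x : x̃ ∈ L^r(0,∞)}` where
`x̃(t) = ess sup_{s ≥ t} |x(s)|`; for `r = ∞` this is `L^∞(0,∞)`. -/
noncomputable def tandNorm (r : ℝ≥0∞) (x : ℝ → ℝ) : ℝ≥0∞ :=
  if r = ⊤ then essSup (fun s => ENNReal.ofReal |x s|) (volume.restrict (Ioi 0))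
  else (∫⁻ t in Ioi (0:ℝ),
      (essSup (fun s => ENNReal.ofReal |x s|) (volume.restrict (Ici t))) ^ r.toReal)
    ^ (r⁻¹).toReal

/-- `x ∈ L̃^r(0,∞)`. -/
def memTand (r : ℝ≥0∞) (x : ℝ → ℝ) : Prop := tandNorm r x ≠ ⊤

/-- The `ℓ^p(ℤ)` norm of a `[0,∞]`-valued sequence. -/
noncomputable def seqNorm (p : ℝ≥0∞) (b : ℤ → ℝ≥0∞) : ℝ≥0∞ :=
  if p = ⊤ then ⨆ k, b k else (∑' k, b k ^ p.toReal) ^ (p⁻¹).toReal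

/-- The dyadic interval `[2^k, 2^(k+1))`. -/
def dyad (k : ℤ) : Set ℝ := Ico ((2 : ℝ) ^ k) ((2 : ℝ) ^ (k + 1))

/-- The geometric weight `2^(a k)`. -/
noncomputable def geomWeight (a : ℝ) (k : ℤ) : ℝ≥0∞ := (2 : ℝ≥0∞) ^ (a * k)

section Sequences

variable {p q r : ℝ≥0∞} {b c : ℤ → ℝ≥0∞}

lemma one_le_toReal_of_ne_top (hp : 1 ≤ p) (h : p ≠ ⊤) : 1 ≤ p.toReal := by
  simpa using ENNReal.toReal_mono h hp

lemma seqNorm_top : seqNorm ⊤ b = ⨆ k, b k := by simp [seqNorm]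

lemma seqNorm_of_ne_top (h : p ≠ ⊤) :
    seqNorm p b = (∑' k, b k ^ p.toReal) ^ p.toReal⁻¹ := by
  simp [seqNorm, h, ENNReal.toReal_inv]

lemma seqNorm_le_iff (hp : 1 ≤ p) (h : p ≠ ⊤) {M : ℝ≥0∞} :
    seqNorm p b ≤ M ↔ ∑' k, b k ^ p.toReal ≤ M ^ p.toReal := by
  have := one_le_toReal_of_ne_top hp h
  rw [seqNorm_of_ne_top h, ENNReal.rpow_inv_le_iff (by linarith)]

lemma seqNorm_mono (h : ∀ k, b k ≤ c k) : seqNorm p b ≤ seqNorm p c := by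
  unfold seqNorm
  split_ifs with hp
  · exact iSup_mono h
  · gcongr with k
    exact h k

lemma le_seqNorm (hp : 1 ≤ p) (k : ℤ) : b k ≤ seqNorm p b := by
  by_cases h : p = ⊤
  · subst h
    rw [seqNorm_top]
    exact le_iSup b k
  · have := one_le_toReal_of_ne_top hp h
    rw [seqNorm_of_ne_top h, ENNReal.le_rpow_inv_iff (by linarith)]
    exact ENNReal.le_tsum (f := fun k => b k ^ p.toReal) k

lemma seqNorm_const_mul (hp : 1 ≤ p) (a : ℝ≥0∞) :
    seqNorm p (fun k => a * b k) = a * seqNorm p b := by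
  by_cases h : p = ⊤
  · subst h
    simp only [seqNorm_top, ENNReal.mul_iSup]
  · have := one_le_toReal_of_ne_top hp h
    have h0 : 0 ≤ p.toReal := by linarith
    simp only [seqNorm_of_ne_top h, ENNReal.mul_rpow_of_nonneg _ _ h0, ENNReal.tsum_mul_left]
    rw [ENNReal.mul_rpow_of_nonneg _ _ (by positivity), ENNReal.rpow_rpow_inv (by linarith)]

lemma seqNorm_comp_equiv (e : ℤ ≃ ℤ) : seqNorm p (fun k => b (e k)) = seqNorm p b := by
  unfold seqNorm
  split_ifs with hp
  · exact e.iSup_comp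
  · rw [e.tsum_eq (fun k => b k ^ p.toReal)]

lemma rpow_tsum_mul_le {P : ℝ} (hP : 1 ≤ P) (w f : ℕ → ℝ≥0∞) :
    (∑' i, w i * f i) ^ P ≤ (∑' i, w i) ^ (P - 1) * ∑' i, w i * f i ^ P := by
  have hP0 : 0 < P := by linarith
  have key : ∑' i, w i * f i ≤ (∑' i, w i) ^ (1 - P⁻¹) * (∑' i, w i * f i ^ P) ^ P⁻¹ := by
    rw [ENNReal.tsum_eq_iSup_sum]
    refine iSup_le fun s => (ENNReal.inner_le_weight_mul_Lp_of_nonneg s hP w f).trans ?_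
    have : 0 ≤ 1 - P⁻¹ := by
      have := inv_le_one_of_one_le₀ hP
      linarith
    gcongr
    · exact ENNReal.sum_le_tsum s
    · exact ENNReal.sum_le_tsum s
  refine (ENNReal.rpow_le_rpow key hP0.le).trans_eq ?_
  rw [ENNReal.mul_rpow_of_nonneg _ _ hP0.le, ENNReal.rpow_inv_rpow hP0.ne', ← ENNReal.rpow_mul]
  congr 2
  field_simp

/-- A weighted countable triangle inequality in `ℓ^p(ℤ)`. -/
lemma seqNorm_tsum_le (hp : 1 ≤ p) (w : ℕ → ℝ≥0∞) (z : ℕ → ℤ → ℝ≥0∞) {M : ℝ≥0∞}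
    (hz : ∀ i, seqNorm p (z i) ≤ M) :
    seqNorm p (fun k => ∑' i, w i * z i k) ≤ (∑' i, w i) * M := by
  by_cases h : p = ⊤
  · subst h
    rw [seqNorm_top]
    refine iSup_le fun k => ?_
    rw [← ENNReal.tsum_mul_right]
    gcongr with i
    exact (le_seqNorm hp k).trans (hz i)
  · have h1 := one_le_toReal_of_ne_top hp h
    rw [seqNorm_le_iff hp h]
    simp only [seqNorm_le_iff hp h] at hz
    set P := p.toReal
    calc ∑' k, (∑' i, w i * z i k) ^ P
        ≤ ∑' k, (∑' i, w i) ^ (P - 1) * ∑' i, w i * z i k ^ P := by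
          gcongr with k
          exact rpow_tsum_mul_le h1 w fun i => z i k
      _ = (∑' i, w i) ^ (P - 1) * ∑' i, w i * ∑' k, z i k ^ P := by
          rw [ENNReal.tsum_mul_left, ENNReal.tsum_comm]
          simp only [ENNReal.tsum_mul_left]
      _ ≤ (∑' i, w i) ^ (P - 1) * ∑' i, w i * M ^ P := by
          gcongr with i
          exact hz i
      _ = ((∑' i, w i) * M) ^ P := by
          rw [ENNReal.tsum_mul_right, ENNReal.mul_rpow_of_nonneg _ _ (by linarith), ← mul_assoc]
          congr 1
          nth_rewrite 2 [← ENNReal.rpow_one (∑' i, w i)]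
          rw [← ENNReal.rpow_add_of_nonneg _ _ (by linarith) (by norm_num)]
          congr 1
          ring

/-- Hölder's inequality in `ℓ^p(ℤ)`. -/
lemma seqNorm_mul_le (hq : 1 ≤ q) (hqp : q ≤ p) (hr : r⁻¹ = q⁻¹ - p⁻¹) :
    seqNorm q (fun k => b k * c k) ≤ seqNorm r b * seqNorm p c := by
  have hp : 1 ≤ p := hq.trans hqp
  have hr1 : 1 ≤ r := by
    rw [← ENNReal.inv_le_inv, hr, inv_one]
    exact tsub_le_self.trans (ENNReal.inv_le_one.2 hq)
  rcases eq_or_ne p ⊤ with rfl | hpt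
  · have : r = q := by simpa using hr
    subst this
    rw [mul_comm, ← seqNorm_const_mul hq]
    refine seqNorm_mono fun k => ?_
    rw [mul_comm]
    gcongr
    exact le_seqNorm hp k
  rcases hqp.eq_or_lt with rfl | hlt
  · rw [← seqNorm_const_mul hq]
    refine seqNorm_mono fun k => ?_
    gcongr
    exact le_seqNorm hr1 k
  have hqt : q ≠ ⊤ := hlt.ne_top
  have hlt' : q.toReal < p.toReal := (ENNReal.toReal_lt_toReal hqt hpt).2 hlt
  have h1 := one_le_toReal_of_ne_top hq hqt
  have hrt : r ≠ ⊤ := by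
    rintro rfl
    rw [ENNReal.inv_top, eq_comm, tsub_eq_zero_iff_le, ENNReal.inv_le_inv] at hr
    exact absurd hr hlt.not_ge
  have hrr : r.toReal⁻¹ = q.toReal⁻¹ - p.toReal⁻¹ := by
    rw [← ENNReal.toReal_inv, hr, ENNReal.toReal_sub_of_le, ENNReal.toReal_inv, ENNReal.toReal_inv]
    · exact ENNReal.inv_le_inv.2 hqp
    · simp only [ne_eq, ENNReal.inv_eq_top]
      exact (zero_lt_one.trans_le hq).ne'
  have := ENNReal.lintegral_Lp_mul_le_Lq_mul_Lr (p := q.toReal) (q := p.toReal) (r := r.toReal)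
    (by linarith) hlt' (by simp only [one_div]; linarith) (Measure.count : Measure ℤ)
    (f := c) (g := b) (measurable_from_top.aemeasurable) (measurable_from_top.aemeasurable)
  simp only [lintegral_count, one_div, Pi.mul_apply] at this
  rw [seqNorm_of_ne_top hqt, seqNorm_of_ne_top hpt, seqNorm_of_ne_top hrt, mul_comm (_ ^ _)]
  simpa only [mul_comm (c _)] using this

lemma geomWeight_add (a a' : ℝ) (k : ℤ) :
    geomWeight (a + a') k = geomWeight a k * geomWeight a' k := by
  rw [geomWeight, add_mul, ENNReal.rpow_add _ _ (by simp) (by simp)]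
  rfl

lemma geomWeight_add_right (a : ℝ) (k l : ℤ) :
    geomWeight a (k + l) = geomWeight a k * geomWeight a l := by
  rw [geomWeight, Int.cast_add, mul_add, ENNReal.rpow_add _ _ (by simp) (by simp)]
  rfl

lemma geomWeight_ne_zero (a : ℝ) (k : ℤ) : geomWeight a k ≠ 0 := by
  simp [geomWeight]

lemma geomWeight_ne_top (a : ℝ) (k : ℤ) : geomWeight a k ≠ ⊤ := by
  simp [geomWeight]

lemma geomWeight_zero (k : ℤ) : geomWeight 0 k = 1 := by simp [geomWeight]

lemma geomWeight_rpow (a s : ℝ) (k : ℤ) : geomWeight a k ^ s = geomWeight (a * s) k := by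
  rw [geomWeight, geomWeight, ← ENNReal.rpow_mul]
  ring_nf

lemma geomWeight_one (k : ℤ) : geomWeight 1 k = ENNReal.ofReal ((2 : ℝ) ^ k) := by
  rw [geomWeight, one_mul, ← Real.rpow_intCast, ← ENNReal.ofReal_rpow_of_pos (by norm_num)]
  simp

lemma tsum_geomWeight_ne_top {a : ℝ} (ha : a < 0) : ∑' i : ℕ, geomWeight a i ≠ ⊤ := by
  have : ∀ i : ℕ, geomWeight a i = (2 ^ a) ^ i := fun i => by
    rw [geomWeight, ENNReal.rpow_mul]
    simp
  simp only [this, ENNReal.tsum_geometric]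
  simp only [ne_eq, ENNReal.inv_eq_top, tsub_eq_zero_iff_le, not_le]
  exact ENNReal.rpow_lt_one_of_one_lt_of_neg (by norm_num) ha

end Sequences

section Dyadic

lemma measurableSet_dyad (k : ℤ) : MeasurableSet (dyad k) := measurableSet_Ico

lemma volume_dyad (k : ℤ) : volume (dyad k) = geomWeight 1 k := by
  rw [dyad, Real.volume_Ico, geomWeight_one, zpow_add_one₀ (by norm_num)]
  ring_nf

lemma le_of_mem_dyad_of_lt {j k : ℤ} {s : ℝ} (hs : s ∈ dyad j) (h : s < (2 : ℝ) ^ (k + 1)) :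
    j ≤ k := by
  have := (zpow_lt_zpow_iff_right₀ (by norm_num : (1 : ℝ) < 2)).1 (hs.1.trans_lt h)
  omega

lemma pairwise_disjoint_dyad : Pairwise (Function.onFun Disjoint dyad) := by
  intro i j hij
  refine Set.disjoint_left.2 fun t hi hj => hij (le_antisymm ?_ ?_)
  · exact le_of_mem_dyad_of_lt hi hj.2
  · exact le_of_mem_dyad_of_lt hj hi.2

lemma iUnion_dyad : ⋃ k, dyad k = Ioi (0 : ℝ) := by
  ext t
  simp only [mem_iUnion, mem_Ioi]
  constructor
  · rintro ⟨k, hk⟩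
    exact lt_of_lt_of_le (by positivity) hk.1
  · exact fun ht => exists_mem_Ico_zpow ht (by norm_num)

lemma ge_of_mem_dyad_of_le {j k : ℤ} {s : ℝ} (hs : s ∈ dyad j) (h : (2 : ℝ) ^ k ≤ s) :
    k ≤ j := by
  have := (zpow_lt_zpow_iff_right₀ (by norm_num : (1 : ℝ) < 2)).1 (h.trans_lt hs.2)
  omega

lemma lintegral_Ioi_eq_tsum (f : ℝ → ℝ≥0∞) :
    ∫⁻ t in Ioi (0 : ℝ), f t = ∑' k, ∫⁻ t in dyad k, f t := by
  rw [← iUnion_dyad, lintegral_iUnion measurableSet_dyad pairwise_disjoint_dyad]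

/-- The `L^p(0,∞)` norm of a `[0,∞]`-valued function. -/
noncomputable def fnNorm (p : ℝ≥0∞) (G : ℝ → ℝ≥0∞) : ℝ≥0∞ :=
  if p = ⊤ then essSup G (volume.restrict (Ioi 0))
  else (∫⁻ t in Ioi (0 : ℝ), G t ^ p.toReal) ^ (p⁻¹).toReal

variable {p : ℝ≥0∞} {G : ℝ → ℝ≥0∞} {g : ℤ → ℝ≥0∞}

lemma rpow_mul_geomWeight (hp : 1 ≤ p) (h : p ≠ ⊤) (k : ℤ) :
    (geomWeight (p⁻¹).toReal k * g k) ^ p.toReal = g k ^ p.toReal * volume (dyad k) := by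
  have := one_le_toReal_of_ne_top hp h
  rw [ENNReal.mul_rpow_of_nonneg _ _ (by linarith), geomWeight_rpow, volume_dyad, mul_comm,
    ENNReal.toReal_inv, inv_mul_cancel₀ (by linarith)]

lemma fnNorm_le_seqNorm (hp : 1 ≤ p) (hg : ∀ k, ∀ t ∈ dyad k, G t ≤ g k) :
    fnNorm p G ≤ seqNorm p (fun k => geomWeight (p⁻¹).toReal k * g k) := by
  rcases eq_or_ne p ⊤ with rfl | h
  · simp only [fnNorm, if_true, seqNorm_top, ENNReal.inv_top, ENNReal.toReal_zero,
      geomWeight_zero, one_mul]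
    refine essSup_le_of_ae_le _ ?_
    refine (ae_restrict_iff' measurableSet_Ioi).2 (ae_of_all _ fun t ht => ?_)
    rw [← iUnion_dyad, mem_iUnion] at ht
    obtain ⟨k, hk⟩ := ht
    exact (hg k t hk).trans (le_iSup g k)
  · simp only [fnNorm, h, if_false, seqNorm, rpow_mul_geomWeight hp h, lintegral_Ioi_eq_tsum]
    gcongr with k
    refine (setLIntegral_mono' (measurableSet_dyad k) (g := fun _ => g k ^ p.toReal) fun t ht =>
      ?_).trans_eq (setLIntegral_const _ _)
    gcongr
    exact hg k t ht

lemma seqNorm_le_fnNorm (hp : 1 ≤ p) (hg : ∀ k, ∀ t ∈ dyad k, g k ≤ G t) :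
    seqNorm p (fun k => geomWeight (p⁻¹).toReal k * g k) ≤ fnNorm p G := by
  rcases eq_or_ne p ⊤ with rfl | h
  · simp only [fnNorm, if_true, seqNorm_top, ENNReal.inv_top, ENNReal.toReal_zero,
      geomWeight_zero, one_mul]
    refine iSup_le fun k => ?_
    have h0 : (volume.restrict (dyad k) : Measure ℝ) ≠ 0 := by
      rw [Ne, Measure.restrict_eq_zero, volume_dyad]
      exact geomWeight_ne_zero 1 k
    rw [← essSup_const (g k) h0]
    refine (essSup_mono_ae ?_).trans (essSup_mono_measure' (Measure.restrict_mono_set _ ?_))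
    · exact (ae_restrict_iff' (measurableSet_dyad k)).2 (ae_of_all _ (hg k))
    · rw [← iUnion_dyad]
      exact subset_iUnion _ k
  · simp only [fnNorm, h, if_false, seqNorm, rpow_mul_geomWeight hp h, lintegral_Ioi_eq_tsum]
    gcongr with k
    rw [← setLIntegral_const]
    refine setLIntegral_mono' (measurableSet_dyad k) fun t ht => ?_
    gcongr
    exact hg k t ht

/-- The integral of `f` over `[2^k, 2^(k+1))`, weighted so that the `ℓ^p` norm of the resulting
sequence is comparable to the norm of `f` in `Ces_p`. -/
noncomputable def cesBlock (p : ℝ≥0∞) (f : ℝ → ℝ≥0∞) (k : ℤ) : ℝ≥0∞ :=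
  geomWeight ((p⁻¹).toReal - 1) k * ∫⁻ t in dyad k, f t

lemma hardyOp_le (x : ℝ → ℝ) {k : ℤ} {t : ℝ} (ht : t ∈ dyad k) :
    hardyOp x t ≤
      geomWeight (-1) k * ∑' i : ℕ, ∫⁻ s in dyad (k - i), ENNReal.ofReal |x s| := by
  have hw : geomWeight (-1) k = (ENNReal.ofReal ((2 : ℝ) ^ k))⁻¹ := by
    rw [← geomWeight_one, ← ENNReal.rpow_neg_one, geomWeight_rpow]
    norm_num
  rw [hardyOp, hw]
  gcongr
  · exact ht.1
  · refine (lintegral_mono_set fun s hs => ?_).trans (lintegral_iUnion_le _ _)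
    obtain ⟨j, hj⟩ := exists_mem_Ico_zpow hs.1 (by norm_num : (1 : ℝ) < 2)
    have hjk : j ≤ k := le_of_mem_dyad_of_lt hj (hs.2.trans ht.2)
    refine mem_iUnion.2 ⟨(k - j).toNat, ?_⟩
    have : k - ((k - j).toNat : ℤ) = j := by omega
    rwa [this]

lemma le_hardyOp (x : ℝ → ℝ) {k : ℤ} {t : ℝ} (ht : t ∈ dyad k) :
    geomWeight (-1) (k + 1) * ∫⁻ s in dyad (k - 1), ENNReal.ofReal |x s| ≤ hardyOp x t := by
  have hw : geomWeight (-1) (k + 1) = (ENNReal.ofReal ((2 : ℝ) ^ (k + 1)))⁻¹ := by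
    rw [← geomWeight_one, ← ENNReal.rpow_neg_one, geomWeight_rpow]
    norm_num
  rw [hardyOp, hw]
  gcongr
  · exact ht.2.le
  · intro s hs
    have h2 := hs.2
    rw [sub_add_cancel] at h2
    exact ⟨lt_of_lt_of_le (by positivity) hs.1, h2.trans_le ht.1⟩

lemma inv_toReal_lt_one (hp : 1 < p) : (p⁻¹).toReal < 1 := by
  have := ENNReal.toReal_strict_mono ENNReal.one_ne_top (ENNReal.inv_lt_one.2 hp)
  simpa using this

lemma seqNorm_comp_sub (b : ℤ → ℝ≥0∞) (i : ℤ) :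
    seqNorm p (fun k => b (k - i)) = seqNorm p b :=
  seqNorm_comp_equiv (Equiv.subRight i)

lemma seqNorm_comp_add (b : ℤ → ℝ≥0∞) (i : ℤ) :
    seqNorm p (fun k => b (k + i)) = seqNorm p b :=
  seqNorm_comp_equiv (Equiv.addRight i)

lemma cesNorm_eq_fnNorm (x : ℝ → ℝ) : cesNorm p x = fnNorm p (hardyOp x) := by
  simp only [cesNorm, fnNorm]

lemma memCes_iff (hp : 1 < p) (x : ℝ → ℝ) :
    memCes p x ↔ seqNorm p (cesBlock p fun t => ENNReal.ofReal |x t|) ≠ ⊤ := by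
  set f : ℝ → ℝ≥0∞ := fun t => ENNReal.ofReal |x t|
  set α := (p⁻¹).toReal with hα
  have hα1 : α < 1 := inv_toReal_lt_one hp
  rw [memCes, cesNorm_eq_fnNorm]
  constructor
  · intro h h'
    have := seqNorm_le_fnNorm hp.le fun k t ht => le_hardyOp x (k := k) ht
    have e : ∀ k : ℤ, geomWeight α k * (geomWeight (-1) (k + 1) * ∫⁻ s in dyad (k - 1), f s) =
        (geomWeight (-1) 1 * geomWeight (α - 1) 1) * cesBlock p f (k - 1) := fun k => by
      obtain ⟨l, rfl⟩ : ∃ l, k = l + 1 := ⟨k - 1, by ring⟩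
      rw [cesBlock, ← hα, sub_eq_add_neg α, geomWeight_add_right _ (l + 1) 1, ← mul_assoc,
        ← mul_assoc, ← geomWeight_add, geomWeight_add_right _ l 1, add_sub_cancel_right]
      ring
    simp only [← hα] at this
    rw [funext e, seqNorm_const_mul hp.le, seqNorm_comp_sub, h', ENNReal.mul_top, top_le_iff]
      at this
    · exact h this
    · exact mul_ne_zero (geomWeight_ne_zero _ _) (geomWeight_ne_zero _ _)
  · intro h
    refine ne_top_of_le_ne_top ?_ (fnNorm_le_seqNorm hp.le fun k t ht => hardyOp_le x ht)
    have e : ∀ k : ℤ, geomWeight α k * (geomWeight (-1) k * ∑' i : ℕ, ∫⁻ s in dyad (k - i), f s) =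
        ∑' i : ℕ, geomWeight (α - 1) i * cesBlock p f (k - i) := fun k => by
      rw [← mul_assoc, ← geomWeight_add, ← sub_eq_add_neg, ← ENNReal.tsum_mul_left]
      refine tsum_congr fun i => ?_
      rw [cesBlock, ← hα, ← mul_assoc, ← geomWeight_add_right, add_sub_cancel]
    rw [← hα, funext e]
    refine ne_top_of_le_ne_top (ENNReal.mul_ne_top (tsum_geomWeight_ne_top ?_) h)
      (seqNorm_tsum_le hp.le _ (fun i k => cesBlock p f (k - i))
        fun i => (seqNorm_comp_sub _ _).le)
    linarith

/-- The essential supremum of `|x|` over `[2^k, 2^(k+1))`, weighted so that the `ℓ^r` norm of the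
resulting sequence is comparable to the norm of `x` in the Tandori space. -/
noncomputable def tandBlock (r : ℝ≥0∞) (x : ℝ → ℝ) (k : ℤ) : ℝ≥0∞ :=
  geomWeight (r⁻¹).toReal k *
    essSup (fun s => ENNReal.ofReal |x s|) (volume.restrict (dyad k))

lemma memTand_iff {r : ℝ≥0∞} (hr : 1 ≤ r) (x : ℝ → ℝ) :
    memTand r x ↔ seqNorm r (tandBlock r x) ≠ ⊤ := by
  set f : ℝ → ℝ≥0∞ := fun t => ENNReal.ofReal |x t| with hf
  set m : ℤ → ℝ≥0∞ := fun k => essSup f (volume.restrict (dyad k)) with hm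
  have hsup : ∀ s : Set ℤ, ∀ᵐ t ∂volume.restrict (⋃ k ∈ s, dyad k), f t ≤ ⨆ k ∈ s, m k := by
    intro s
    refine (ae_restrict_biUnion_iff _ s.to_countable _).2 fun k hk => ?_
    filter_upwards [ENNReal.ae_le_essSup (μ := volume.restrict (dyad k)) f] with t ht
    exact ht.trans (le_iSup₂ (f := fun k (_ : k ∈ s) => m k) k hk)
  rcases eq_or_ne r ⊤ with rfl | h
  · have e : tandBlock ⊤ x = m := by
      ext k
      simp [tandBlock, geomWeight_zero, hm, hf]
    have : tandNorm ⊤ x = seqNorm ⊤ (tandBlock ⊤ x) := by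
      rw [e, seqNorm_top, tandNorm, if_pos rfl]
      apply le_antisymm
      · refine essSup_le_of_ae_le _ ?_
        have := hsup univ
        simp only [mem_univ, iUnion_true, iUnion_dyad, iSup_pos] at this
        exact this
      · refine iSup_le fun k => essSup_mono_measure' (Measure.restrict_mono_set _ ?_)
        rw [← iUnion_dyad]
        exact subset_iUnion _ k
    rw [memTand, this]
  · set v : ℝ → ℝ≥0∞ := fun t => essSup f (volume.restrict (Ici t)) with hv
    set a := (r⁻¹).toReal with ha
    have ha0 : 0 < a := by
      have := one_le_toReal_of_ne_top hr h
      rw [ha, ENNReal.toReal_inv]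
      positivity
    have e0 : tandNorm r x = fnNorm r v := by
      simp only [tandNorm, fnNorm, h, if_false, hv, hf]
    rw [memTand, e0]
    constructor
    · intro hfin h'
      have := seqNorm_le_fnNorm (G := v) (g := fun k => m (k + 1)) hr fun k t ht => by
        refine essSup_mono_measure' (Measure.restrict_mono_set _ fun s hs => ?_)
        exact ht.2.le.trans hs.1
      have e : ∀ k, geomWeight a k * m (k + 1) = geomWeight a (-1) * tandBlock r x (k + 1) := by
        intro k
        rw [tandBlock, ← mul_assoc, ← geomWeight_add_right]
        ring_nf
        rfl
      rw [← ha, funext e, seqNorm_const_mul hr, seqNorm_comp_add, h', ENNReal.mul_top,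
        top_le_iff] at this
      · exact hfin this
      · exact geomWeight_ne_zero _ _
    · intro hfin
      have hle : ∀ k, ∀ t ∈ dyad k, v t ≤ ∑' i : ℕ, m (k + i) := by
        intro k t ht
        have hsub : Ici t ⊆ ⋃ j ∈ Ici k, dyad j := by
          intro s hs
          have hts : t ≤ s := hs
          have h2 : (2 : ℝ) ^ k ≤ s := ht.1.trans hts
          obtain ⟨j, hj⟩ := exists_mem_Ico_zpow (lt_of_lt_of_le (by positivity) h2)
            (by norm_num : (1 : ℝ) < 2)
          exact mem_iUnion₂.2 ⟨j, ge_of_mem_dyad_of_le hj h2, hj⟩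
        refine essSup_le_of_ae_le _ ?_
        filter_upwards [ae_restrict_of_ae_restrict_of_subset hsub (hsup (Ici k))] with s hs
        refine hs.trans (iSup₂_le fun j hj => ?_)
        have hkj : k ≤ j := hj
        have : j = k + ((j - k).toNat : ℤ) := by omega
        rw [this]
        exact ENNReal.le_tsum (f := fun i : ℕ => m (k + i)) (j - k).toNat
      refine ne_top_of_le_ne_top ?_ (fnNorm_le_seqNorm hr hle)
      have e : ∀ k : ℤ, geomWeight a k * ∑' i : ℕ, m (k + i) =
          ∑' i : ℕ, geomWeight (-a) i * tandBlock r x (k + i) := fun k => by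
        rw [← ENNReal.tsum_mul_left]
        refine tsum_congr fun i => ?_
        have : geomWeight a k = geomWeight (-a) i * geomWeight a (k + i) := by
          rw [geomWeight_add_right, mul_left_comm, ← geomWeight_add, neg_add_cancel,
            geomWeight_zero, mul_one]
        rw [tandBlock, ← mul_assoc, ← ha, ← this]
      rw [← ha, funext e]
      refine ne_top_of_le_ne_top (ENNReal.mul_ne_top (tsum_geomWeight_ne_top ?_) hfin)
        (seqNorm_tsum_le hr _ (fun i k => tandBlock r x (k + i))
          fun i => (seqNorm_comp_add _ _).le)
      linarith

end Dyadic

section Multipliers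

variable {p q r : ℝ≥0∞}

lemma one_le_of_inv_eq_sub (hq : 1 ≤ q) (hr : r⁻¹ = q⁻¹ - p⁻¹) : 1 ≤ r := by
  rw [← ENNReal.inv_le_inv, hr, inv_one]
  exact tsub_le_self.trans (ENNReal.inv_le_one.2 hq)

lemma inv_toReal_eq_sub (hq : 1 ≤ q) (hqp : q ≤ p) (hr : r⁻¹ = q⁻¹ - p⁻¹) :
    (r⁻¹).toReal = (q⁻¹).toReal - (p⁻¹).toReal := by
  rw [hr, ENNReal.toReal_sub_of_le (ENNReal.inv_le_inv.2 hqp)]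
  simp only [ne_eq, ENNReal.inv_eq_top]
  exact (zero_lt_one.trans_le hq).ne'

lemma cesBlock_mul_le (hq : 1 ≤ q) (hqp : q ≤ p) (hr : r⁻¹ = q⁻¹ - p⁻¹) (x : ℝ → ℝ)
    {f : ℝ → ℝ≥0∞} (hf : Measurable f) (k : ℤ) :
    cesBlock q (fun t => ENNReal.ofReal |x t| * f t) k ≤ tandBlock r x k * cesBlock p f k := by
  have e : (q⁻¹).toReal - 1 = (r⁻¹).toReal + ((p⁻¹).toReal - 1) := by
    rw [inv_toReal_eq_sub hq hqp hr]
    ring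
  rw [cesBlock, tandBlock, cesBlock, e, geomWeight_add, mul_mul_mul_comm,
    ← lintegral_const_mul _ hf]
  refine mul_le_mul' le_rfl (lintegral_mono_ae ?_)
  filter_upwards [ENNReal.ae_le_essSup (μ := volume.restrict (dyad k))
    fun s => ENNReal.ofReal |x s|] with t ht
  gcongr

lemma cesBlock_tsum {ι : Type*} [Countable ι] (a : ι → ℝ≥0∞) {f : ι → ℝ → ℝ≥0∞}
    (hf : ∀ i, Measurable (f i)) (k : ℤ) :
    cesBlock p (fun t => ∑' i, a i * f i t) k = ∑' i, a i * cesBlock p (f i) k := by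
  rw [cesBlock, lintegral_tsum fun i => ((hf i).const_mul _).aemeasurable,
    ← ENNReal.tsum_mul_left]
  refine tsum_congr fun i => ?_
  rw [lintegral_const_mul _ (hf i), cesBlock, mul_left_comm]

lemma exists_cesBlock_bound (hp : 1 ≤ p) (hq : 1 ≤ q) {X : ℝ → ℝ≥0∞} (hX : Measurable X)
    (H : ∀ f : ℝ → ℝ≥0∞, Measurable f → seqNorm p (cesBlock p f) ≠ ⊤ →
      seqNorm q (cesBlock q fun t => X t * f t) ≠ ⊤) :
    ∃ C : ℝ≥0∞, C ≠ ⊤ ∧ ∀ f : ℝ → ℝ≥0∞, Measurable f → seqNorm p (cesBlock p f) ≤ 1 →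
      seqNorm q (cesBlock q fun t => X t * f t) ≤ C := by
  by_contra! hcon
  choose f hf hf1 hfn using fun n : ℕ => hcon ((2 : ℝ≥0∞) ^ n * 2 ^ n) (by finiteness)
  set w : ℕ → ℝ≥0∞ := fun n => (2⁻¹ : ℝ≥0∞) ^ n with hw
  have hF : Measurable fun t => ∑' n, w n * f n t :=
    Measurable.tsum fun n => (hf n).const_mul _
  have h1 : seqNorm p (cesBlock p fun t => ∑' n, w n * f n t) ≠ ⊤ := by
    rw [funext (cesBlock_tsum w hf)]
    refine ne_top_of_le_ne_top ?_ (seqNorm_tsum_le hp w _ hf1)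
    simp [hw, ENNReal.tsum_geometric]
  have h2 := H _ hF h1
  have h3 : ∀ n : ℕ, (n : ℝ≥0∞) ≤ seqNorm q (cesBlock q fun t => X t * ∑' n, w n * f n t) := by
    intro n
    calc (n : ℝ≥0∞) ≤ 2 ^ n := by exact_mod_cast Nat.lt_two_pow_self.le
      _ = w n * (2 ^ n * 2 ^ n) := by
        rw [hw, ← mul_assoc, ← mul_pow, ENNReal.inv_mul_cancel (by simp) (by simp), one_pow,
          one_mul]
      _ ≤ w n * seqNorm q (cesBlock q fun t => X t * f n t) := by
        gcongr
        exact (hfn n).le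
      _ = seqNorm q (fun k => w n * cesBlock q (fun t => X t * f n t) k) :=
        (seqNorm_const_mul hq _).symm
      _ ≤ _ := by
        refine seqNorm_mono fun k => ?_
        rw [cesBlock, cesBlock, mul_left_comm, ← lintegral_const_mul (f := fun t => X t * f n t) _ (hX.mul (hf n))]
        refine mul_le_mul' le_rfl (lintegral_mono fun t => ?_)
        rw [mul_left_comm]
        gcongr
        exact ENNReal.le_tsum (f := fun n => w n * f n t) n
  obtain ⟨n, hn⟩ := ENNReal.exists_nat_gt h2
  exact absurd (h3 n) hn.not_ge

lemma exists_density {X : ℝ → ℝ≥0∞} (hX : Measurable X) (k : ℤ) {l : ℝ≥0∞}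
    (hl : l < essSup X (volume.restrict (dyad k)) ∨ l = 0) :
    ∃ g : ℝ → ℝ≥0∞, Measurable g ∧ (∀ t ∉ dyad k, g t = 0) ∧ ∫⁻ t in dyad k, g t = 1 ∧
      l ≤ ∫⁻ t in dyad k, X t * g t := by
  set B := {t | l ≤ X t} ∩ dyad k with hB
  have hBm : MeasurableSet B := (measurableSet_le measurable_const hX).inter (measurableSet_dyad k)
  have hB0 : volume B ≠ 0 := by
    rcases hl with hl | rfl
    · intro h0
      refine hl.not_ge (essSup_le_of_ae_le _ ?_)
      have : ∀ᵐ t ∂volume.restrict (dyad k), ¬ l ≤ X t := by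
        rw [ae_iff, Measure.restrict_apply' (measurableSet_dyad k)]
        simpa only [not_not] using h0
      filter_upwards [this] with t ht
      exact (not_le.1 ht).le
    · have : B = dyad k := by
        ext t
        simp [hB]
      rw [this, volume_dyad]
      exact geomWeight_ne_zero _ _
  have hBt : volume B ≠ ⊤ := by
    refine ne_top_of_le_ne_top ?_ (measure_mono (inter_subset_right : B ⊆ dyad k))
    rw [volume_dyad]
    exact geomWeight_ne_top _ _
  have hgm : Measurable (B.indicator fun _ => (volume B)⁻¹) := measurable_const.indicator hBm
  have hg1 : ∫⁻ t in dyad k, B.indicator (fun _ => (volume B)⁻¹) t = 1 := by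
    rw [lintegral_indicator_const hBm, Measure.restrict_apply hBm,
      inter_eq_left.2 inter_subset_right, ENNReal.inv_mul_cancel hB0 hBt]
  refine ⟨_, hgm, fun t ht => indicator_of_notMem (fun h => ht h.2) _, hg1, ?_⟩
  rw [← mul_one l, ← hg1, ← lintegral_const_mul _ hgm]
  refine lintegral_mono fun t => ?_
  by_cases ht : t ∈ B
  · exact mul_le_mul_left ht.1 _
  · simp [ht]

lemma exists_seqNorm_bound (hq : 1 ≤ q) (hqp : q ≤ p) (hr : r⁻¹ = q⁻¹ - p⁻¹) {x : ℝ → ℝ}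
    (hx : Measurable x)
    (H : ∀ f : ℝ → ℝ≥0∞, Measurable f → seqNorm p (cesBlock p f) ≠ ⊤ →
      seqNorm q (cesBlock q fun t => ENNReal.ofReal |x t| * f t) ≠ ⊤) :
    ∃ C : ℝ≥0∞, C ≠ ⊤ ∧ ∀ l c : ℤ → ℝ≥0∞, (∀ k, l k < tandBlock r x k ∨ l k = 0) →
      seqNorm p c ≠ ⊤ → seqNorm q (fun k => l k * c k) ≤ C * seqNorm p c := by
  have hp : 1 ≤ p := hq.trans hqp
  have hX : Measurable fun t => ENNReal.ofReal |x t| := by fun_prop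
  obtain ⟨C, hC, hbound⟩ := exists_cesBlock_bound hp hq hX H
  refine ⟨C, hC, fun l c hl hc => ?_⟩
  set ρ := (r⁻¹).toReal with hρ
  have hρe : ρ = (q⁻¹).toReal - (p⁻¹).toReal := inv_toReal_eq_sub hq hqp hr
  have hcancel : ∀ k, geomWeight ρ k * geomWeight (-ρ) k = 1 := fun k => by
    rw [← geomWeight_add, add_neg_cancel, geomWeight_zero]
  have unit : ∀ c : ℤ → ℝ≥0∞, seqNorm p c ≤ 1 → seqNorm q (fun k => l k * c k) ≤ C := by
    intro c hc
    have hd : ∀ k, geomWeight (-ρ) k * l k <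
        essSup (fun s => ENNReal.ofReal |x s|) (volume.restrict (dyad k)) ∨
        geomWeight (-ρ) k * l k = 0 := fun k => by
      refine (hl k).imp (fun h => ?_) (fun h => by rw [h, mul_zero])
      by_contra! hle
      refine h.not_ge ?_
      calc tandBlock r x k ≤ geomWeight ρ k * (geomWeight (-ρ) k * l k) := by
            rw [tandBlock]
            gcongr
        _ = l k := by rw [← mul_assoc, hcancel, one_mul]
    choose g hgm hg0 hg1 hgl using fun k => exists_density hX k (hd k)
    have hoff : ∀ j k, j ≠ k → ∀ t ∈ dyad k, g j t = 0 := fun j k hjk t ht =>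
      hg0 j t fun h => disjoint_left.1 (pairwise_disjoint_dyad hjk) h ht
    set a : ℤ → ℝ≥0∞ := fun k => c k * geomWeight (1 - (p⁻¹).toReal) k with ha
    have hval : ∀ k, ∀ t ∈ dyad k, ∑' j, a j * g j t = a k * g k t := fun k t ht =>
      tsum_eq_single k fun j hj => by rw [hoff j k hj t ht, mul_zero]
    have hfm : Measurable fun t => ∑' j, a j * g j t :=
      Measurable.tsum fun n => (hgm n).const_mul _
    have hblock : cesBlock p (fun t => ∑' j, a j * g j t) = c := by
      ext k
      rw [cesBlock, setLIntegral_congr_fun (measurableSet_dyad k) (hval k),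
        lintegral_const_mul _ (hgm k), hg1, mul_one, ha, mul_left_comm, ← geomWeight_add]
      ring_nf
      rw [geomWeight_zero, mul_one]
    refine le_trans (seqNorm_mono fun k => ?_) (hbound _ hfm (by rwa [hblock]))
    calc l k * c k = geomWeight ((q⁻¹).toReal - 1) k * (a k * (geomWeight (-ρ) k * l k)) := by
          have : geomWeight ((q⁻¹).toReal - 1) k * geomWeight (1 - (p⁻¹).toReal) k *
              geomWeight (-ρ) k = 1 := by
            rw [← geomWeight_add, ← geomWeight_add, hρe]
            ring_nf
            exact geomWeight_zero k
          calc l k * c k = l k * c k * (geomWeight ((q⁻¹).toReal - 1) k *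
                geomWeight (1 - (p⁻¹).toReal) k * geomWeight (-ρ) k) := by rw [this, mul_one]
            _ = _ := by
              simp only [ha]
              ring
      _ ≤ geomWeight ((q⁻¹).toReal - 1) k *
          (a k * ∫⁻ t in dyad k, ENNReal.ofReal |x t| * g k t) := by
        gcongr
        exact hgl k
      _ = cesBlock q (fun t => ENNReal.ofReal |x t| * ∑' j, a j * g j t) k := by
        rw [cesBlock, ← lintegral_const_mul (f := fun t => ENNReal.ofReal |x t| * g k t) _
          (hX.mul (hgm k))]
        congr 1
        refine setLIntegral_congr_fun (measurableSet_dyad k) fun t ht => ?_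
        simp only [hval k t ht]
        ring
  rcases eq_or_ne (seqNorm p c) 0 with h0 | h0
  · have : ∀ k, c k = 0 := fun k => by
      have := le_seqNorm (b := c) hp k
      rwa [h0, nonpos_iff_eq_zero] at this
    have e : (fun k => l k * c k) = fun k => 0 * c k := by
      ext k
      rw [this, mul_zero, mul_zero]
    rw [e, seqNorm_const_mul hq, zero_mul]
    exact zero_le
  · have := unit (fun k => (seqNorm p c)⁻¹ * c k) (by
      rw [seqNorm_const_mul hp, ENNReal.inv_mul_cancel h0 hc])
    simp only [mul_left_comm (l _)] at this
    rw [seqNorm_const_mul hq, mul_comm, ← div_eq_mul_inv, ENNReal.div_le_iff h0 hc] at this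
    exact this

lemma seqNorm_single_one (hp : 1 ≤ p) (k : ℤ) : seqNorm p (Pi.single k 1) = 1 := by
  rcases eq_or_ne p ⊤ with rfl | h
  · rw [seqNorm_top]
    refine le_antisymm (iSup_le fun j => ?_) ?_
    · by_cases hj : j = k
      · subst hj
        simp
      · simp [hj]
    · exact le_iSup_of_le k (by simp)
  · have := one_le_toReal_of_ne_top hp h
    rw [seqNorm_of_ne_top h, tsum_eq_single k fun j hj => ?_]
    · simp
    · rw [Pi.single_eq_of_ne hj, ENNReal.zero_rpow_of_pos (by linarith)]

lemma seqNorm_le_of_multiplier (hq : 1 ≤ q) (hqp : q ≤ p) (hr : r⁻¹ = q⁻¹ - p⁻¹) (hrt : r ≠ ⊤)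
    {l : ℤ → ℝ≥0∞} (hl : ∀ k, l k ≠ ⊤) {C : ℝ≥0∞}
    (hC : ∀ c, seqNorm p c ≠ ⊤ → seqNorm q (fun k => l k * c k) ≤ C * seqNorm p c) :
    seqNorm r l ≤ C := by
  have hr1 := one_le_of_inv_eq_sub hq hr
  have hp : 1 ≤ p := hq.trans hqp
  have hρ := inv_toReal_eq_sub hq hqp hr
  have hqt : q ≠ ⊤ := by
    rintro rfl
    simp at hr
    exact hrt hr
  have hR := one_le_toReal_of_ne_top hr1 hrt
  have hQ := one_le_toReal_of_ne_top hq hqt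
  rw [seqNorm_le_iff hr1 hrt, ENNReal.tsum_eq_iSup_sum]
  refine iSup_le fun F => ?_
  set R := r.toReal with hRdef
  set Q := q.toReal with hQdef
  set α := (p⁻¹).toReal with hα
  have hα0 : 0 ≤ α := ENNReal.toReal_nonneg
  rw [ENNReal.toReal_inv, ENNReal.toReal_inv] at hρ
  set S := ∑ k ∈ F, l k ^ R with hS
  have hSt : S ≠ ⊤ := ENNReal.sum_ne_top.2 fun k _ =>
    ENNReal.rpow_ne_top_of_nonneg (by linarith) (hl k)
  rcases eq_or_ne S 0 with h0 | h0
  · rw [h0]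
    exact zero_le
  set c : ℤ → ℝ≥0∞ := fun k => if k ∈ F then l k ^ (R * α) else 0 with hc
  have hcp : seqNorm p c ≤ S ^ α := by
    rcases eq_or_ne p ⊤ with hpt | hpt
    · have : α = 0 := by simp [hα, hpt]
      rw [hpt, seqNorm_top, this, ENNReal.rpow_zero]
      refine iSup_le fun k => ?_
      simp only [hc, this, mul_zero, ENNReal.rpow_zero]
      split_ifs <;> simp
    · have hP := one_le_toReal_of_ne_top hp hpt
      rw [seqNorm_of_ne_top hpt, tsum_eq_sum (s := F), hα, ENNReal.toReal_inv]
      · refine ENNReal.rpow_le_rpow (Finset.sum_le_sum fun k hk => ?_) (by positivity)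
        simp only [hc, hk, if_true]
        rw [← ENNReal.rpow_mul, hα, ENNReal.toReal_inv, mul_assoc,
          inv_mul_cancel₀ (by linarith), mul_one]
      · intro k hk
        simp only [hc, hk, if_false]
        exact ENNReal.zero_rpow_of_pos (by linarith)
  have hlq : S ^ Q⁻¹ ≤ seqNorm q (fun k => l k * c k) := by
    rw [seqNorm_of_ne_top hqt]
    refine ENNReal.rpow_le_rpow (le_trans (Finset.sum_le_sum fun k hk => ?_)
      (ENNReal.sum_le_tsum F)) (by positivity)
    simp only [hc, hk, if_true]
    nth_rewrite 2 [← ENNReal.rpow_one (l k)]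
    rw [← ENNReal.rpow_add_of_nonneg _ _ (by norm_num) (by positivity), ← ENNReal.rpow_mul]
    refine le_of_eq ?_
    congr 1
    have : (1 + R * α) = R * Q⁻¹ := by
      have : Q⁻¹ = R⁻¹ + α := by linarith
      rw [this, mul_add, mul_inv_cancel₀ (by linarith)]
    rw [this, mul_assoc, inv_mul_cancel₀ (by linarith), mul_one]
  have hfin : S ^ α ≠ ⊤ := ENNReal.rpow_ne_top_of_nonneg hα0 hSt
  have key : S ^ Q⁻¹ ≤ C * S ^ α := by
    refine hlq.trans ((hC c (ne_top_of_le_ne_top hfin hcp)).trans ?_)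
    gcongr
  rw [← ENNReal.rpow_inv_le_iff (by linarith), hρ, ENNReal.rpow_sub _ _ h0 hSt]
  exact ENNReal.div_le_of_le_mul key

lemma seqNorm_tandBlock_ne_top (hq : 1 ≤ q) (hqp : q ≤ p) (hr : r⁻¹ = q⁻¹ - p⁻¹) {x : ℝ → ℝ}
    (hx : Measurable x)
    (H : ∀ f : ℝ → ℝ≥0∞, Measurable f → seqNorm p (cesBlock p f) ≠ ⊤ →
      seqNorm q (cesBlock q fun t => ENNReal.ofReal |x t| * f t) ≠ ⊤) :
    seqNorm r (tandBlock r x) ≠ ⊤ := by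
  have hp : 1 ≤ p := hq.trans hqp
  have hr1 := one_le_of_inv_eq_sub hq hr
  obtain ⟨C, hC, hbound⟩ := exists_seqNorm_bound hq hqp hr hx H
  have hn : ∀ k, tandBlock r x k ≤ C := by
    refine fun k => le_of_forall_lt fun l hl => ?_
    obtain ⟨l', hl', hl''⟩ := exists_between hl
    refine hl'.trans_le ?_
    have := hbound (Pi.single k l') (Pi.single k 1) (fun j => ?_) ?_
    · rw [seqNorm_single_one hp, mul_one] at this
      refine le_trans ?_ ((le_seqNorm hq k).trans this)
      simp
    · by_cases hj : j = k
      · subst hj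
        simp [hl'']
      · simp [hj]
    · simp [seqNorm_single_one hp]
  rcases eq_or_ne r ⊤ with rfl | hrt
  · rw [seqNorm_top]
    exact ne_top_of_le_ne_top hC (iSup_le hn)
  · have hnt : ∀ k, tandBlock r x k ≠ ⊤ := fun k => ne_top_of_le_ne_top hC (hn k)
    have := seqNorm_le_of_multiplier (l := fun k => 2⁻¹ * tandBlock r x k) hq hqp hr hrt
      (fun k => ENNReal.mul_ne_top (by simp) (hnt k)) (C := C) fun c hc =>
        hbound _ c (fun k => ?_) hc
    · rw [seqNorm_const_mul hr1] at this
      intro h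
      rw [h, ENNReal.mul_top (by simp), top_le_iff] at this
      exact hC this
    · rcases eq_or_ne (tandBlock r x k) 0 with h0 | h0
      · right
        rw [h0, mul_zero]
      · left
        rw [mul_comm, ← div_eq_mul_inv]
        exact ENNReal.half_lt_self h0 (hnt k)

lemma multiplier_ennreal (hp : 1 < p) (hq : 1 < q) {x : ℝ → ℝ}
    (h : ∀ y : ℝ → ℝ, Measurable y → memCes p y → memCes q (fun t => x t * y t))
    {f : ℝ → ℝ≥0∞} (hf : Measurable f) (hfp : seqNorm p (cesBlock p f) ≠ ⊤) :
    seqNorm q (cesBlock q fun t => ENNReal.ofReal |x t| * f t) ≠ ⊤ := by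
  have hy := h (fun t => (f t).toReal) hf.ennreal_toReal
  rw [memCes_iff hp, memCes_iff hq] at hy
  have hfin : ∀ k, ∫⁻ t in dyad k, f t ≠ ⊤ := fun k hk => by
    have := le_seqNorm (b := cesBlock p f) hp.le k
    rw [cesBlock, hk, ENNReal.mul_top (geomWeight_ne_zero _ _), top_le_iff] at this
    exact hfp this
  have hcongr : ∀ k, ∀ᵐ t ∂volume.restrict (dyad k), ENNReal.ofReal |(f t).toReal| = f t := by
    intro k
    filter_upwards [ae_lt_top hf (hfin k)] with t ht
    rw [abs_of_nonneg ENNReal.toReal_nonneg, ENNReal.ofReal_toReal ht.ne]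
  have e1 : (cesBlock p fun t => ENNReal.ofReal |(f t).toReal|) = cesBlock p f := by
    ext k
    rw [cesBlock, cesBlock, lintegral_congr_ae (hcongr k)]
  have e2 : (cesBlock q fun t => ENNReal.ofReal |x t * (f t).toReal|) =
      cesBlock q fun t => ENNReal.ofReal |x t| * f t := by
    ext k
    rw [cesBlock, cesBlock]
    congr 1
    refine lintegral_congr_ae ?_
    filter_upwards [hcongr k] with t ht
    rw [abs_mul, ENNReal.ofReal_mul (abs_nonneg _), ht]
  rw [e1, e2] at hy
  exact hy hfp

end Multipliers

/-- for `1 < q ≤ p ≤ ∞` and `1/r = 1/q − 1/p` (so `r = ∞` when `p = q`),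
`M(Ces_p(0,∞), Ces_q(0,∞)) = L̃^r(0,∞)`. -/
theorem stmt16 (p q r : ℝ≥0∞) (hq : 1 < q) (hqp : q ≤ p)
    (hr : r⁻¹ = q⁻¹ - p⁻¹)
    (x : ℝ → ℝ) (hx : Measurable x) :
    (∀ y : ℝ → ℝ, Measurable y → memCes p y → memCes q (fun t => x t * y t)) ↔
      memTand r x := by
  have hp : 1 < p := hq.trans_le hqp
  have hr1 := one_le_of_inv_eq_sub hq.le hr
  rw [memTand_iff hr1]
  constructor
  · intro h
    exact seqNorm_tandBlock_ne_top hq.le hqp hr hx fun f hf hfp =>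
      multiplier_ennreal hp hq h hf hfp
  · intro h y hy hyp
    rw [memCes_iff hp] at hyp
    rw [memCes_iff hq]
    refine ne_top_of_le_ne_top (ENNReal.mul_ne_top h hyp)
      (le_trans (seqNorm_mono fun k => ?_) (seqNorm_mul_le hq.le hqp hr))
    simp only [abs_mul, ENNReal.ofReal_mul (abs_nonneg _)]
    exact cesBlock_mul_le hq.le hqp hr x (by fun_prop) k
end

section
/- Let 1 < q ≤ p ≤ ∞ and define r by 1/r = 1/q − 1/p (r = ∞ when p = q). Then Ces_q(0,∞) = Ces_p(0,∞) ⊙ L̃^r(0,∞): every u ∈ Ces_q(0,∞) can be written as u = x·z with x ∈ Ces_p(0,∞) and z ∈ L̃^r(0,∞), and conversely x·z ∈ Ces_q(0,∞) whenever x ∈ Ces_p(0,∞) and z ∈ L̃^r(0,∞). -/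
open MeasureTheory Set
open scoped ENNReal

theorem setLIntegral_Ioi_comp_half {f : ℝ → ℝ≥0∞} (hf : Measurable f) :
    ∫⁻ t in Ioi (0:ℝ), f (t / 2) = 2 * ∫⁻ t in Ioi (0:ℝ), f t := by
  have h := Real.smul_map_volume_mul_left (a := (1 / 2 : ℝ)) (by norm_num)
  have hhalf : ENNReal.ofReal |(1 / 2 : ℝ)| = 2⁻¹ := by
    rw [abs_of_pos (by norm_num), one_div, ENNReal.ofReal_inv_of_pos two_pos]
    simp
  have hind : ∀ t : ℝ, (Ioi (0:ℝ)).indicator (fun t => f (t / 2)) t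
      = (Ioi (0:ℝ)).indicator f (1 / 2 * t) := by
    intro t
    by_cases ht : 0 < t
    · rw [indicator_of_mem (show t ∈ Ioi 0 from ht),
        indicator_of_mem (show 1 / 2 * t ∈ Ioi 0 by simpa using ht)]
      congr 1; ring
    · rw [indicator_of_notMem (show t ∉ Ioi 0 from ht),
        indicator_of_notMem (show 1 / 2 * t ∉ Ioi 0 by simpa using ht)]
  have hm : Measurable ((Ioi (0:ℝ)).indicator f) := hf.indicator measurableSet_Ioi
  rw [← lintegral_indicator measurableSet_Ioi, ← lintegral_indicator measurableSet_Ioi]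
  simp_rw [hind]
  conv_rhs => rw [← h, lintegral_smul_measure, lintegral_map hm (by fun_prop), hhalf, smul_eq_mul,
    ← mul_assoc, ENNReal.mul_inv_cancel two_ne_zero ENNReal.ofNat_ne_top, one_mul]

/-- Partial sums of the dilation series `∑ₖ 2⁻ᵏ g(t / 2ᵏ)`. -/
noncomputable def dilationSum (g : ℝ → ℝ≥0∞) : ℕ → ℝ → ℝ≥0∞
  | 0 => 0
  | n + 1 => (fun t => 2⁻¹ * dilationSum g n (t / 2)) + g

theorem measurable_dilationSum {g : ℝ → ℝ≥0∞} (hg : Measurable g) (n : ℕ) :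
    Measurable (dilationSum g n) := by
  induction n with
  | zero => exact measurable_zero
  | succ n ih => exact ((ih.comp (measurable_id.div_const 2)).const_mul _).add hg

theorem monotone_dilationSum (g : ℝ → ℝ≥0∞) : Monotone (dilationSum g) := by
  refine monotone_nat_of_le_succ fun n => ?_
  induction n with
  | zero => exact fun _ => zero_le
  | succ n ih =>
    intro t
    simp only [dilationSum, Pi.add_apply]
    gcongr
    exact ih _

theorem half_mul_two_rpow_lt_one {q : ℝ} (hq : 1 < q) : (2⁻¹ * 2 ^ (1 / q) : ℝ≥0∞) < 1 := by
  have h2 : (2 : ℝ≥0∞) ^ (1 / q) < 2 ^ (1 : ℝ) :=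
    ENNReal.rpow_lt_rpow_of_exponent_lt (by norm_num) (by norm_num)
      (by rw [div_lt_one (by linarith)]; exact hq)
  rw [ENNReal.rpow_one] at h2
  rw [mul_comm, ← div_eq_mul_inv]
  exact ENNReal.div_lt_of_lt_mul (by simpa using h2)

theorem lintegral_dilationSum_le {g : ℝ → ℝ≥0∞} (hg : Measurable g) {q : ℝ} (hq : 1 < q) (n : ℕ) :
    (∫⁻ t in Ioi (0:ℝ), dilationSum g n t ^ q) ^ (1 / q)
      ≤ (∫⁻ t in Ioi (0:ℝ), g t ^ q) ^ (1 / q) * (1 - 2⁻¹ * 2 ^ (1 / q))⁻¹ := by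
  have hq0 : 0 < q := by linarith
  set c : ℝ≥0∞ := 2⁻¹ * 2 ^ (1 / q) with hc
  have hc1 : c < 1 := half_mul_two_rpow_lt_one hq
  have hsub : 1 - c ≠ 0 := (tsub_pos_of_lt hc1).ne'
  have hsub' : 1 - c ≠ ⊤ := ne_top_of_le_ne_top ENNReal.one_ne_top tsub_le_self
  set B := (∫⁻ t in Ioi (0:ℝ), g t ^ q) ^ (1 / q)
  have hfix : c * (B * (1 - c)⁻¹) + B = B * (1 - c)⁻¹ := by
    have h1 : c * (1 - c)⁻¹ + 1 = (1 - c)⁻¹ := by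
      nth_rewrite 2 [← ENNReal.mul_inv_cancel hsub hsub']
      rw [← add_mul, add_tsub_cancel_of_le hc1.le, one_mul]
    calc c * (B * (1 - c)⁻¹) + B = B * (c * (1 - c)⁻¹ + 1) := by ring
      _ = _ := by rw [h1]
  induction n with
  | zero => simp [dilationSum, hq0]
  | succ n ih =>
    have hm := measurable_dilationSum hg n
    have hscale : (∫⁻ t in Ioi (0:ℝ), (2⁻¹ * dilationSum g n (t / 2)) ^ q) ^ (1 / q)
        = c * (∫⁻ t in Ioi (0:ℝ), dilationSum g n t ^ q) ^ (1 / q) := by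
      simp_rw [ENNReal.mul_rpow_of_nonneg _ _ hq0.le]
      rw [lintegral_const_mul (2⁻¹ ^ q) (f := fun t => dilationSum g n (t / 2) ^ q)
          ((hm.comp (measurable_id.div_const 2)).pow_const q),
        setLIntegral_Ioi_comp_half (f := fun t => dilationSum g n t ^ q) (hm.pow_const q),
        ENNReal.mul_rpow_of_nonneg _ _ (by positivity),
        ENNReal.mul_rpow_of_nonneg _ _ (by positivity), ← ENNReal.rpow_mul,
        mul_one_div_cancel hq0.ne', ENNReal.rpow_one, hc, mul_assoc]
    calc _ ≤ (∫⁻ t in Ioi (0:ℝ), (2⁻¹ * dilationSum g n (t / 2)) ^ q) ^ (1 / q) + B :=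
          ENNReal.lintegral_Lp_add_le
            ((hm.comp (measurable_id.div_const 2)).const_mul _).aemeasurable hg.aemeasurable hq.le
      _ ≤ c * (B * (1 - c)⁻¹) + B := by rw [hscale]; gcongr
      _ = _ := hfix

theorem lintegral_iSup_dilationSum_ne_top {g : ℝ → ℝ≥0∞} (hg : Measurable g) {q : ℝ} (hq : 1 < q)
    (hfin : ∫⁻ t in Ioi (0:ℝ), g t ^ q ≠ ⊤) :
    ∫⁻ t in Ioi (0:ℝ), (⨆ n, dilationSum g n t) ^ q ≠ ⊤ := by
  have hq0 : 0 < q := by linarith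
  have hsup : ∀ t, (⨆ n, dilationSum g n t) ^ q = ⨆ n, dilationSum g n t ^ q := fun t =>
    (ENNReal.orderIsoRpow q hq0).map_iSup _
  simp_rw [hsup]
  rw [lintegral_iSup (fun n => (measurable_dilationSum hg n).pow_const q)
    (fun m n hmn t => ENNReal.rpow_le_rpow (monotone_dilationSum g hmn t) hq0.le)]
  have hK : ((∫⁻ t in Ioi (0:ℝ), g t ^ q) ^ (1 / q) * (1 - 2⁻¹ * 2 ^ (1 / q))⁻¹) ^ q ≠ ⊤ := by
    refine ENNReal.rpow_ne_top_of_nonneg hq0.le (ENNReal.mul_ne_top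
      (ENNReal.rpow_ne_top_of_nonneg (by positivity) hfin) (ENNReal.inv_ne_top.2 ?_))
    exact (tsub_pos_of_lt (half_mul_two_rpow_lt_one hq)).ne'
  refine ne_top_of_le_ne_top hK (iSup_le fun n => ?_)
  have := ENNReal.rpow_le_rpow (lintegral_dilationSum_le hg hq n) hq0.le
  rwa [← ENNReal.rpow_mul, one_div_mul_cancel hq0.ne', ENNReal.rpow_one] at this

theorem measurable_hardyOp (x : ℝ → ℝ) : Measurable (hardyOp x) := by
  have hmono : Monotone fun t => ∫⁻ s in Ioo (0:ℝ) t, ENNReal.ofReal |x s| := fun a b hab =>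
    lintegral_mono_set (Ioo_subset_Ioo_right hab)
  exact ENNReal.measurable_ofReal.inv.mul hmono.measurable

theorem hardyOp_le_const_mul {x y : ℝ → ℝ} {C : ℝ≥0∞}
    (h : ∀ᵐ s ∂(volume.restrict (Ioi (0:ℝ))), ENNReal.ofReal |y s| ≤ C * ENNReal.ofReal |x s|)
    (hx : Measurable x) (t : ℝ) : hardyOp y t ≤ C * hardyOp x t := by
  have hI : ∫⁻ s in Ioo (0:ℝ) t, ENNReal.ofReal |y s|
      ≤ C * ∫⁻ s in Ioo (0:ℝ) t, ENNReal.ofReal |x s| := by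
    rw [← lintegral_const_mul _ (by fun_prop)]
    exact lintegral_mono_ae (ae_mono (Measure.restrict_mono Ioo_subset_Ioi_self le_rfl) h)
  calc hardyOp y t ≤ (ENNReal.ofReal t)⁻¹ * (C * ∫⁻ s in Ioo (0:ℝ) t, ENNReal.ofReal |x s|) := by
        unfold hardyOp; gcongr
    _ = C * hardyOp x t := by unfold hardyOp; ring

theorem memCes_top_iff {x : ℝ → ℝ} :
    memCes ⊤ x ↔ essSup (fun t => hardyOp x t) (volume.restrict (Ioi 0)) ≠ ⊤ := by
  simp [memCes, cesNorm]

theorem memCes_iff_s18 {p : ℝ≥0∞} (hp0 : p ≠ 0) (hp : p ≠ ⊤) {x : ℝ → ℝ} :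
    memCes p x ↔ ∫⁻ t in Ioi (0:ℝ), hardyOp x t ^ p.toReal ≠ ⊤ := by
  have hpos : 0 < p⁻¹.toReal := ENNReal.toReal_pos (by simpa) (by simpa)
  rw [memCes, cesNorm, if_neg hp, Ne, ENNReal.rpow_eq_top_iff_of_pos hpos]

theorem memTand_top_iff {x : ℝ → ℝ} :
    memTand ⊤ x ↔ essSup (fun s => ENNReal.ofReal |x s|) (volume.restrict (Ioi 0)) ≠ ⊤ := by
  simp [memTand, tandNorm]

theorem memTand_iff_s18 {r : ℝ≥0∞} (hr0 : r ≠ 0) (hr : r ≠ ⊤) {x : ℝ → ℝ} :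
    memTand r x ↔ ∫⁻ t in Ioi (0:ℝ),
      (essSup (fun s => ENNReal.ofReal |x s|) (volume.restrict (Ici t))) ^ r.toReal ≠ ⊤ := by
  have hpos : 0 < r⁻¹.toReal := ENNReal.toReal_pos (by simpa) (by simpa)
  rw [memTand, tandNorm, if_neg hr, Ne, ENNReal.rpow_eq_top_iff_of_pos hpos]

theorem memCes_of_hardyOp_le {p : ℝ≥0∞} (hp0 : p ≠ 0) {x y : ℝ → ℝ} {C : ℝ≥0∞} (hC : C ≠ ⊤)
    (h : ∀ t, hardyOp y t ≤ C * hardyOp x t) (hx : memCes p x) : memCes p y := by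
  rcases eq_or_ne p ⊤ with rfl | hp
  · rw [memCes_top_iff] at hx ⊢
    refine ne_top_of_le_ne_top (ENNReal.mul_ne_top hC hx) (essSup_le_of_ae_le _ ?_)
    filter_upwards [ENNReal.ae_le_essSup (fun t => hardyOp x t)] with t ht
    exact (h t).trans (by gcongr)
  · rw [memCes_iff_s18 hp0 hp] at hx ⊢
    refine ne_top_of_le_ne_top (ENNReal.mul_ne_top
      (ENNReal.rpow_ne_top_of_nonneg (y := p.toReal) ENNReal.toReal_nonneg hC) hx) ?_
    rw [← lintegral_const_mul _ ((measurable_hardyOp x).pow_const _)]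
    refine lintegral_mono fun t => ?_
    rw [← ENNReal.mul_rpow_of_nonneg _ _ ENNReal.toReal_nonneg]
    exact ENNReal.rpow_le_rpow (h t) ENNReal.toReal_nonneg

/-- The least decreasing majorant of `|z|`, up to null sets. -/
noncomputable def tandMajorant (z : ℝ → ℝ) (t : ℝ) : ℝ≥0∞ :=
  essSup (fun s => ENNReal.ofReal |z s|) (volume.restrict (Ici t))

theorem measurable_tandMajorant (z : ℝ → ℝ) : Measurable (tandMajorant z) := by
  have : Antitone (tandMajorant z) := fun a b hab =>
    essSup_mono_measure (Measure.absolutelyContinuous_of_le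
      (Measure.restrict_mono (Ici_subset_Ici.2 hab) le_rfl))
  exact this.measurable

theorem ofReal_inv_eq_half (t : ℝ) :
    (ENNReal.ofReal t)⁻¹ = 2⁻¹ * (ENNReal.ofReal (t / 2))⁻¹ := by
  rw [← ENNReal.mul_inv (by simp) (by simp)]
  congr 1
  rw [← ENNReal.ofReal_ofNat 2, ← ENNReal.ofReal_mul (by norm_num)]
  congr 1; ring

theorem lintegral_Ico_le_dilationSum {u x z : ℝ → ℝ} (hx : Measurable x)
    (h : ∀ᵐ s ∂(volume.restrict (Ioi (0:ℝ))), u s = x s * z s) (n : ℕ) {t : ℝ} (ht : 0 < t) :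
    (ENNReal.ofReal t)⁻¹ * ∫⁻ s in Ico (t / 2 ^ n) t, ENNReal.ofReal |u s|
      ≤ dilationSum (fun t => tandMajorant z (t / 2) * hardyOp x t) n t := by
  induction n generalizing t with
  | zero => simp
  | succ n ih =>
    have hblock : ∫⁻ s in Ico (t / 2) t, ENNReal.ofReal |u s|
        ≤ tandMajorant z (t / 2) * ∫⁻ s in Ioo (0:ℝ) t, ENNReal.ofReal |x s| := by
      calc ∫⁻ s in Ico (t / 2) t, ENNReal.ofReal |u s|
          ≤ ∫⁻ s in Ico (t / 2) t, tandMajorant z (t / 2) * ENNReal.ofReal |x s| := by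
            refine lintegral_mono_ae ?_
            have h1 := ae_mono (Measure.restrict_mono (μ := volume)
              (show Ico (t / 2) t ⊆ Ioi 0 from fun s hs => (half_pos ht).trans_le hs.1) le_rfl) h
            have h2 := ae_mono (Measure.restrict_mono (μ := volume)
              (show Ico (t / 2) t ⊆ Ici (t / 2) from Ico_subset_Ici_self) le_rfl)
              (ENNReal.ae_le_essSup (μ := volume.restrict (Ici (t / 2)))
                fun s => ENNReal.ofReal |z s|)
            filter_upwards [h1, h2] with s hs1 hs2
            rw [hs1, abs_mul, ENNReal.ofReal_mul (abs_nonneg _), mul_comm]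
            exact mul_le_mul_left hs2 _
        _ = tandMajorant z (t / 2) * ∫⁻ s in Ico (t / 2) t, ENNReal.ofReal |x s| :=
            lintegral_const_mul _ (by fun_prop)
        _ ≤ _ := by
            refine mul_le_mul_right (lintegral_mono_set ?_) _
            exact fun s hs => ⟨(half_pos ht).trans_le hs.1, hs.2⟩
    have hsplit : Ico (t / 2 ^ (n + 1)) t ⊆ Ico (t / 2 / 2 ^ n) (t / 2) ∪ Ico (t / 2) t := by
      rw [pow_succ', ← div_div]
      exact Ico_subset_Ico_union_Ico
    calc _ ≤ (ENNReal.ofReal t)⁻¹ * ((∫⁻ s in Ico (t / 2 / 2 ^ n) (t / 2), ENNReal.ofReal |u s|)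
            + ∫⁻ s in Ico (t / 2) t, ENNReal.ofReal |u s|) :=
          mul_le_mul_right ((lintegral_mono_set hsplit).trans (lintegral_union_le _ _ _)) _
      _ ≤ 2⁻¹ * ((ENNReal.ofReal (t / 2))⁻¹
              * ∫⁻ s in Ico (t / 2 / 2 ^ n) (t / 2), ENNReal.ofReal |u s|)
            + (ENNReal.ofReal t)⁻¹
              * (tandMajorant z (t / 2) * ∫⁻ s in Ioo (0:ℝ) t, ENNReal.ofReal |x s|) := by
          rw [mul_add, ← mul_assoc, ← ofReal_inv_eq_half]
          gcongr
      _ ≤ _ := by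
          simp only [dilationSum, Pi.add_apply]
          refine add_le_add (mul_le_mul_right (ih (half_pos ht)) _) (le_of_eq ?_)
          unfold hardyOp; ring

theorem hardyOp_le_iSup_dilationSum {u x z : ℝ → ℝ} (hx : Measurable x)
    (h : ∀ᵐ s ∂(volume.restrict (Ioi (0:ℝ))), u s = x s * z s) {t : ℝ} (ht : 0 < t) :
    hardyOp u t ≤ ⨆ n, dilationSum (fun t => tandMajorant z (t / 2) * hardyOp x t) n t := by
  have hsub : Ioo 0 t ⊆ ⋃ n : ℕ, Ico (t / 2 ^ n) t := by
    intro s hs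
    obtain ⟨n, hn⟩ := pow_unbounded_of_one_lt (t / s) (one_lt_two)
    refine mem_iUnion.2 ⟨n, ?_, hs.2⟩
    rw [div_lt_iff₀ hs.1] at hn
    rw [div_le_iff₀ (by positivity)]
    linarith
  have hdir : Directed (· ⊆ ·) fun n : ℕ => Ico (t / 2 ^ n) t :=
    Monotone.directed_le fun m n hmn => Ico_subset_Ico_left
      (div_le_div_of_nonneg_left ht.le (by positivity) (pow_le_pow_right₀ one_le_two hmn))
  calc hardyOp u t
      ≤ (ENNReal.ofReal t)⁻¹ * ∫⁻ s in ⋃ n : ℕ, Ico (t / 2 ^ n) t, ENNReal.ofReal |u s| :=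
        mul_le_mul_right (lintegral_mono_set hsub) _
    _ = ⨆ n : ℕ, (ENNReal.ofReal t)⁻¹ * ∫⁻ s in Ico (t / 2 ^ n) t, ENNReal.ofReal |u s| := by
        rw [setLIntegral_iUnion_of_directed _ hdir, ENNReal.mul_iSup]
    _ ≤ _ := iSup_mono fun n => lintegral_Ico_le_dilationSum hx h n ht

theorem memCes_of_ae_eq_mul {p q r : ℝ≥0∞} (hq : 1 < q) (hqp : q < p) (hr0 : r ≠ 0) (hr' : r ≠ ⊤)
    (hr : 1 / q.toReal = 1 / p.toReal + 1 / r.toReal)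
    {u x z : ℝ → ℝ} (hx : Measurable x) (hxp : memCes p x) (hzr : memTand r z)
    (h : ∀ᵐ s ∂(volume.restrict (Ioi (0:ℝ))), u s = x s * z s) : memCes q u := by
  have hqt : q ≠ ⊤ := hqp.ne_top
  have hq0 : q ≠ 0 := (zero_lt_one.trans hq).ne'
  have hq1 : 1 < q.toReal := by
    rw [← ENNReal.toReal_one]; exact (ENNReal.toReal_lt_toReal ENNReal.one_ne_top hqt).2 hq
  have hw : Measurable fun t => tandMajorant z (t / 2) :=
    (measurable_tandMajorant z).comp (measurable_id.div_const 2)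
  have hwr : ∫⁻ t in Ioi (0:ℝ), tandMajorant z (t / 2) ^ r.toReal ≠ ⊤ := by
    rw [setLIntegral_Ioi_comp_half (f := fun t => tandMajorant z t ^ r.toReal)
      ((measurable_tandMajorant z).pow_const _)]
    exact ENNReal.mul_ne_top ENNReal.ofNat_ne_top ((memTand_iff_s18 hr0 hr').1 hzr)
  have hg : ∫⁻ t in Ioi (0:ℝ), (tandMajorant z (t / 2) * hardyOp x t) ^ q.toReal ≠ ⊤ := by
    rcases eq_or_ne p ⊤ with rfl | hp
    · have hqr : q.toReal = r.toReal := by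
        simpa using hr
      rw [memCes_top_iff] at hxp
      refine ne_top_of_le_ne_top (ENNReal.mul_ne_top hwr
        (ENNReal.rpow_ne_top_of_nonneg (y := r.toReal) ENNReal.toReal_nonneg hxp)) ?_
      rw [← lintegral_mul_const _ (hw.pow_const _), hqr]
      refine lintegral_mono_ae ?_
      filter_upwards [ENNReal.ae_le_essSup (fun t => hardyOp x t)] with t ht
      rw [← ENNReal.mul_rpow_of_nonneg _ _ ENNReal.toReal_nonneg]
      gcongr
    · rw [memCes_iff_s18 (hq0.bot_lt.trans hqp).ne' hp] at hxp
      have hlt : q.toReal < p.toReal := (ENNReal.toReal_lt_toReal hqt hp).2 hqp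
      have hH := ENNReal.lintegral_Lp_mul_le_Lq_mul_Lr (by linarith) hlt hr
        (volume.restrict (Ioi (0:ℝ))) (measurable_hardyOp x).aemeasurable hw.aemeasurable
      have hfin := ne_top_of_le_ne_top (ENNReal.mul_ne_top
        (ENNReal.rpow_ne_top_of_nonneg (by positivity) hxp)
        (ENNReal.rpow_ne_top_of_nonneg (by positivity) hwr)) hH
      rw [Ne, ENNReal.rpow_eq_top_iff_of_pos (by positivity)] at hfin
      simpa only [Pi.mul_apply, mul_comm] using hfin
  rw [memCes_iff_s18 hq0 hqt]
  refine ne_top_of_le_ne_top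
    (lintegral_iSup_dilationSum_ne_top (hw.mul (measurable_hardyOp x)) hq1 hg) ?_
  refine setLIntegral_mono' measurableSet_Ioi fun t ht => ?_
  exact ENNReal.rpow_le_rpow (hardyOp_le_iSup_dilationSum hx h ht) ENNReal.toReal_nonneg

/-- A positive decreasing function which dominates `(Hu)^q` up to a constant and is integrable on
`(0,∞)` when `Hu ∈ L^q`. -/
noncomputable def cesMajorant (q : ℝ) (u : ℝ → ℝ) (t : ℝ) : ℝ≥0∞ :=
  (∫⁻ s in Ioi t, hardyOp u s ^ q * (ENNReal.ofReal s)⁻¹) + ENNReal.ofReal (Real.exp (-t))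

theorem antitone_cesMajorant (q : ℝ) (u : ℝ → ℝ) : Antitone (cesMajorant q u) := fun a b hab => by
  unfold cesMajorant
  gcongr

theorem cesMajorant_ne_zero (q : ℝ) (u : ℝ → ℝ) (t : ℝ) : cesMajorant q u t ≠ 0 := by
  simp [cesMajorant, Real.exp_pos]

theorem cesMajorant_ne_top {q : ℝ} {u : ℝ → ℝ}
    (h : ∫⁻ t in Ioi (0:ℝ), hardyOp u t ^ q ≠ ⊤) {t : ℝ} (ht : 0 < t) :
    cesMajorant q u t ≠ ⊤ := by
  refine ENNReal.add_ne_top.2 ⟨?_, ENNReal.ofReal_ne_top⟩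
  have hinv : (ENNReal.ofReal t)⁻¹ ≠ ⊤ := by simpa using ht
  refine ne_top_of_le_ne_top (ENNReal.mul_ne_top h hinv) ?_
  rw [← lintegral_mul_const _ ((measurable_hardyOp u).pow_const _)]
  calc _ ≤ ∫⁻ s in Ioi t, hardyOp u s ^ q * (ENNReal.ofReal t)⁻¹ := by
        refine setLIntegral_mono' measurableSet_Ioi fun s hs => ?_
        have : t ≤ s := le_of_lt hs
        gcongr
    _ ≤ _ := lintegral_mono_set (Ioi_subset_Ioi ht.le)

theorem lintegral_cesMajorant_ne_top {q : ℝ} {u : ℝ → ℝ}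
    (h : ∫⁻ t in Ioi (0:ℝ), hardyOp u t ^ q ≠ ⊤) :
    ∫⁻ t in Ioi (0:ℝ), cesMajorant q u t ≠ ⊤ := by
  unfold cesMajorant
  rw [lintegral_add_right _ (by fun_prop)]
  refine ENNReal.add_ne_top.2 ⟨?_, ?_⟩
  · set F : ℝ → ℝ≥0∞ := fun s => hardyOp u s ^ q * (ENNReal.ofReal s)⁻¹ with hF
    have hFm : Measurable F :=
      ((measurable_hardyOp u).pow_const _).mul ENNReal.measurable_ofReal.inv
    have hswap : ∫⁻ t in Ioi (0:ℝ), ∫⁻ s in Ioi t, F s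
        = ∫⁻ s, ∫⁻ t in Ioi (0:ℝ), (Ioi t).indicator F s := by
      rw [← lintegral_lintegral_swap]
      · exact lintegral_congr fun t => (lintegral_indicator measurableSet_Ioi _).symm
      · have hset : MeasurableSet {a : ℝ × ℝ | a.1 < a.2} :=
          measurableSet_lt measurable_fst measurable_snd
        exact ((hFm.comp measurable_snd).indicator hset).aemeasurable
    rw [hswap]
    refine ne_top_of_le_ne_top h ?_
    rw [← lintegral_indicator measurableSet_Ioi]
    refine lintegral_mono fun s => ?_
    have hin : ∫⁻ t in Ioi (0:ℝ), (Ioi t).indicator F s = F s * ENNReal.ofReal s := by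
      have : ∀ t, (Ioi t).indicator F s = (Iio s).indicator (fun _ => F s) t := fun t => by
        simp only [indicator, mem_Ioi, mem_Iio]
      simp_rw [this]
      rw [lintegral_indicator measurableSet_Iio, setLIntegral_const,
        Measure.restrict_apply measurableSet_Iio, Iio_inter_Ioi, Real.volume_Ioo, sub_zero]
    rw [hin]
    by_cases hs : 0 < s
    · rw [indicator_of_mem (show s ∈ Ioi 0 from hs), hF, mul_assoc,
        ENNReal.inv_mul_cancel (by simpa using hs) ENNReal.ofReal_ne_top, mul_one]
    · rw [ENNReal.ofReal_of_nonpos (not_lt.1 hs), mul_zero]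
      exact zero_le
  · exact (integrableOn_exp_neg_Ioi 0).lintegral_lt_top.ne

theorem hardyOp_half_le (u : ℝ → ℝ) {t s : ℝ} (hts : t ≤ s) (hst : s ≤ 2 * t) :
    hardyOp u t * 2⁻¹ ≤ hardyOp u s := by
  have h2 : (ENNReal.ofReal t)⁻¹ * 2⁻¹ = (ENNReal.ofReal (2 * t))⁻¹ := by
    rw [ofReal_inv_eq_half (2 * t), mul_comm]; congr; ring
  unfold hardyOp
  rw [mul_right_comm, h2]
  gcongr

theorem hardyOp_le_cesMajorant {q : ℝ} (hq : 0 < q) (u : ℝ → ℝ) {t : ℝ} (ht : 0 < t) :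
    hardyOp u t ≤ 2 * 2 ^ (1 / q) * cesMajorant q u t ^ (1 / q) := by
  have hkey : (hardyOp u t * 2⁻¹) ^ q * 2⁻¹ ≤ cesMajorant q u t := by
    have hvol : (ENNReal.ofReal (2 * t))⁻¹ * ENNReal.ofReal t = 2⁻¹ := by
      rw [ofReal_inv_eq_half, mul_div_cancel_left₀ _ two_ne_zero, mul_assoc,
        ENNReal.inv_mul_cancel (by simpa using ht) ENNReal.ofReal_ne_top, mul_one]
    calc (hardyOp u t * 2⁻¹) ^ q * 2⁻¹
        = ∫⁻ _ in Ioo t (2 * t), (hardyOp u t * 2⁻¹) ^ q * (ENNReal.ofReal (2 * t))⁻¹ := by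
          rw [setLIntegral_const, Real.volume_Ioo, show 2 * t - t = t by ring, mul_assoc, hvol]
      _ ≤ ∫⁻ s in Ioo t (2 * t), hardyOp u s ^ q * (ENNReal.ofReal s)⁻¹ := by
          refine setLIntegral_mono' measurableSet_Ioo fun s hs => ?_
          have h1 := hardyOp_half_le u hs.1.le hs.2.le
          have h2 := hs.2.le
          gcongr
      _ ≤ ∫⁻ s in Ioi t, hardyOp u s ^ q * (ENNReal.ofReal s)⁻¹ :=
          lintegral_mono_set Ioo_subset_Ioi_self
      _ ≤ _ := le_self_add
  have h3 := ENNReal.rpow_le_rpow hkey (show 0 ≤ 1 / q by positivity)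
  rw [ENNReal.mul_rpow_of_nonneg _ _ (by positivity), ← ENNReal.rpow_mul,
    mul_one_div_cancel hq.ne', ENNReal.rpow_one, ENNReal.inv_rpow] at h3
  have h20 : (2 : ℝ≥0∞) ^ (1 / q) ≠ 0 := by simp
  have h2t : (2 : ℝ≥0∞) ^ (1 / q) ≠ ⊤ := ENNReal.rpow_ne_top_of_nonneg (by positivity) (by simp)
  calc hardyOp u t
      = 2 * 2 ^ (1 / q) * (hardyOp u t * 2⁻¹ * (2 ^ (1 / q))⁻¹) := by
        rw [show 2 * 2 ^ (1 / q) * (hardyOp u t * 2⁻¹ * (2 ^ (1 / q))⁻¹)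
          = hardyOp u t * (2 * 2⁻¹) * (2 ^ (1 / q) * (2 ^ (1 / q))⁻¹) by ring,
          ENNReal.mul_inv_cancel h20 h2t, ENNReal.mul_inv_cancel (by simp) (by simp),
          mul_one, mul_one]
    _ ≤ _ := by gcongr

theorem exists_ces_tandori_factorization {p q r : ℝ≥0∞} (hq : 1 < q) (hqp : q < p) (hr0 : r ≠ 0)
    (hr' : r ≠ ⊤) (hr : 1 / q.toReal = 1 / p.toReal + 1 / r.toReal)
    {u : ℝ → ℝ} (hu : Measurable u) (huq : memCes q u) :
    ∃ x z : ℝ → ℝ, Measurable x ∧ Measurable z ∧ memCes p x ∧ memTand r z ∧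
      (∀ᵐ t ∂(volume.restrict (Ioi (0:ℝ))), u t = x t * z t) := by
  have hqt : q ≠ ⊤ := hqp.ne_top
  have hq0 : q ≠ 0 := (zero_lt_one.trans hq).ne'
  have hqpos : 0 < q.toReal := ENNReal.toReal_pos hq0 hqt
  have hrpos : 0 < r.toReal := ENNReal.toReal_pos hr0 hr'
  rw [memCes_iff_s18 hq0 hqt] at huq
  set m := cesMajorant q.toReal u with hm
  have hm0 : ∀ t, m t ≠ 0 := cesMajorant_ne_zero _ _
  have hmt : ∀ t, 0 < t → m t ≠ ⊤ := fun t ht => cesMajorant_ne_top huq ht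
  have hma : Antitone m := antitone_cesMajorant _ _
  have hmm : Measurable m := hma.measurable
  have hmi : ∫⁻ t in Ioi (0:ℝ), m t ≠ ⊤ := lintegral_cesMajorant_ne_top huq
  set z : ℝ → ℝ := fun t => (m t ^ (1 / r.toReal)).toReal with hz
  have hzm : Measurable z := (hmm.pow_const _).ennreal_toReal
  have hpt : ∀ t, 0 < t → m t ^ (1 / r.toReal) ≠ ⊤ := fun t ht =>
    ENNReal.rpow_ne_top_of_nonneg (by positivity) (hmt t ht)
  have hzo : ∀ t, 0 < t → ENNReal.ofReal (z t) = m t ^ (1 / r.toReal) := fun t ht =>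
    ENNReal.ofReal_toReal (hpt t ht)
  have hzpos : ∀ t, 0 < t → 0 < z t := fun t ht =>
    ENNReal.toReal_pos (by simp [hm0 t, hmt t ht]) (hpt t ht)
  have hHx : ∀ t, 0 < t → hardyOp (fun s => u s / z s) t
      ≤ 2 * 2 ^ (1 / q.toReal) * m t ^ (1 / p.toReal) := by
    intro t ht
    have hI : ∫⁻ s in Ioo 0 t, ENNReal.ofReal |u s / z s|
        ≤ (m t ^ (1 / r.toReal))⁻¹ * ∫⁻ s in Ioo 0 t, ENNReal.ofReal |u s| := by
      rw [← lintegral_const_mul _ (by fun_prop)]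
      refine setLIntegral_mono' measurableSet_Ioo fun s hs => ?_
      rw [abs_div, abs_of_pos (hzpos s hs.1), ENNReal.ofReal_div_of_pos (hzpos s hs.1),
        hzo s hs.1, div_eq_mul_inv, mul_comm]
      have := hma hs.2.le
      gcongr
    calc hardyOp (fun s => u s / z s) t
        ≤ (ENNReal.ofReal t)⁻¹ *
          ((m t ^ (1 / r.toReal))⁻¹ * ∫⁻ s in Ioo 0 t, ENNReal.ofReal |u s|) := by
          unfold hardyOp; gcongr
      _ = hardyOp u t * m t ^ (-(1 / r.toReal)) := by
          rw [ENNReal.rpow_neg]; unfold hardyOp; ring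
      _ ≤ 2 * 2 ^ (1 / q.toReal) * m t ^ (1 / q.toReal) * m t ^ (-(1 / r.toReal)) := by
          gcongr
          exact hardyOp_le_cesMajorant hqpos u ht
      _ = _ := by
          rw [mul_assoc, ← ENNReal.rpow_add _ _ (hm0 t) (hmt t ht), hr, add_neg_cancel_right]
  have hC : (2 : ℝ≥0∞) * 2 ^ (1 / q.toReal) ≠ ⊤ := ENNReal.mul_ne_top (by simp)
    (ENNReal.rpow_ne_top_of_nonneg (by positivity) (by simp))
  refine ⟨fun s => u s / z s, z, hu.div hzm, hzm, ?_, ?_, ?_⟩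
  · rcases eq_or_ne p ⊤ with rfl | hp
    · rw [memCes_top_iff]
      refine ne_top_of_le_ne_top hC (essSup_le_of_ae_le _ ?_)
      filter_upwards [ae_restrict_mem measurableSet_Ioi] with t ht
      simpa using hHx t ht
    · have hp0 : p ≠ 0 := (hq0.bot_lt.trans hqp).ne'
      have hppos : 0 < p.toReal := ENNReal.toReal_pos hp0 hp
      rw [memCes_iff_s18 hp0 hp]
      refine ne_top_of_le_ne_top (ENNReal.mul_ne_top
        (ENNReal.rpow_ne_top_of_nonneg hppos.le hC) hmi) ?_
      rw [← lintegral_const_mul _ hmm]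
      refine setLIntegral_mono' measurableSet_Ioi fun t ht => ?_
      refine (ENNReal.rpow_le_rpow (hHx t ht) hppos.le).trans (le_of_eq ?_)
      rw [ENNReal.mul_rpow_of_nonneg _ _ hppos.le, ← ENNReal.rpow_mul (m t),
        one_div_mul_cancel hppos.ne', ENNReal.rpow_one]
  · rw [memTand_iff_s18 hr0 hr']
    refine ne_top_of_le_ne_top hmi (setLIntegral_mono' measurableSet_Ioi fun t ht => ?_)
    have hle : essSup (fun s => ENNReal.ofReal |z s|) (volume.restrict (Ici t))
        ≤ m t ^ (1 / r.toReal) := by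
      refine essSup_le_of_ae_le _ ?_
      filter_upwards [ae_restrict_mem measurableSet_Ici] with s hs
      have hs0 : 0 < s := lt_of_lt_of_le ht hs
      rw [abs_of_pos (hzpos s hs0), hzo s hs0]
      have := hma hs
      gcongr
    refine (ENNReal.rpow_le_rpow hle hrpos.le).trans (le_of_eq ?_)
    rw [← ENNReal.rpow_mul, one_div_mul_cancel hrpos.ne', ENNReal.rpow_one]
  · filter_upwards [ae_restrict_mem measurableSet_Ioi] with t ht
    exact (div_mul_cancel₀ _ (hzpos t ht).ne').symm

/-- for `1 < q ≤ p ≤ ∞` and `1/r = 1/q − 1/p` (so `r = ∞` when `p = q`),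
`Ces_q(0,∞) = Ces_p(0,∞) ⊙ L̃^r(0,∞)`: every `u ∈ Ces_q` factors as `u = x·z`
with `x ∈ Ces_p` and `z ∈ L̃^r`, and conversely every such product lies in `Ces_q`. -/
theorem stmt18 (p q r : ℝ≥0∞) (hq : 1 < q) (hqp : q ≤ p)
    (hr : r⁻¹ = q⁻¹ - p⁻¹)
    (u : ℝ → ℝ) (hu : Measurable u) :
    memCes q u ↔
      ∃ x z : ℝ → ℝ, Measurable x ∧ Measurable z ∧ memCes p x ∧ memTand r z ∧
        (∀ᵐ t ∂(volume.restrict (Ioi (0:ℝ))), u t = x t * z t) := by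
  have hq0 : q ≠ 0 := (zero_lt_one.trans hq).ne'
  rcases hqp.eq_or_lt with rfl | hlt
  · obtain rfl : r = ⊤ := by simpa using hr
    constructor
    · intro h
      refine ⟨u, fun _ => 1, hu, measurable_const, h, ?_, by simp⟩
      rw [memTand_top_iff]
      refine ne_top_of_le_ne_top ENNReal.one_ne_top (essSup_le_of_ae_le _ ?_)
      filter_upwards with t
      simp
    · rintro ⟨x, z, hx, -, hxp, hzr, h⟩
      rw [memTand_top_iff] at hzr
      refine memCes_of_hardyOp_le hq0 hzr (hardyOp_le_const_mul ?_ hx) hxp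
      filter_upwards [h, ENNReal.ae_le_essSup fun s => ENNReal.ofReal |z s|] with s hs hzs
      rw [hs, abs_mul, ENNReal.ofReal_mul (abs_nonneg _), mul_comm]
      exact mul_le_mul_left hzs _
  · have hinv : p⁻¹ < q⁻¹ := ENNReal.inv_lt_inv.2 hlt
    have hqi : q⁻¹ ≠ ⊤ := by simpa
    have hr' : r ≠ ⊤ := by
      rintro rfl
      exact (tsub_pos_of_lt hinv).ne (by simpa using hr)
    have hr0 : r ≠ 0 := by
      rintro rfl
      exact ne_top_of_le_ne_top hqi tsub_le_self (by rw [← hr]; exact ENNReal.inv_zero)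
    have hrR : 1 / q.toReal = 1 / p.toReal + 1 / r.toReal := by
      have h := congrArg ENNReal.toReal hr
      rw [ENNReal.toReal_sub_of_le hinv.le hqi] at h
      simp only [ENNReal.toReal_inv] at h
      simp only [one_div]
      linarith
    constructor
    · exact exists_ces_tandori_factorization hq hlt hr0 hr' hrR hu
    · rintro ⟨x, z, hx, -, hxp, hzr, h⟩
      exact memCes_of_ae_eq_mul hq hlt hr0 hr' hrR hx hxp hzr h
end
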